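/- Let ω ∈ W_0 satisfy γ(ω) > 1. Then for every γ with 0 < γ < min(2, γ(ω) − 1) and every l > 0 there exist an integer d'' ≥ 1 and a continuous linear operator E : Λ¹_{ω,l} → A_{ω,d''l}(S_γ) such that for every λ ∈ Λ¹_{ω,l} and every p ∈ ℕ, the p-th derivative of E(λ) tends to λ_p as z → 0 within S_γ. In particular, for every such γ and every sequence λ with |λ|_{ω,l} < ∞ for some l > 0, there exists f holomorphic on S_γ with ‖f‖_{ω,l'} < ∞ for some l' > 0 and f^{(p)}(z) → λ_p as z → 0 in S_γ for all p (surjectivity of the Borel map on the Roumieu class). -/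

import Mathlib

open Filter MeasureTheory Set Asymptotics

noncomputable section

/-- A *weight function*: continuous and nondecreasing on `[0,∞)`, vanishing at `0`,
and tending to `+∞` at `+∞`. -/
structure IsWeightFunction (ω : ℝ → ℝ) : Prop where
  continuousOn : ContinuousOn ω (Set.Ici 0)
  monotoneOn : MonotoneOn ω (Set.Ici 0)
  map_zero : ω 0 = 0
  tendsto_atTop : Filter.Tendsto ω Filter.atTop Filter.atTop

/-- Condition `(P_{ω,γ})`: there is `K > 1` with `limsup_{t→∞} ω(K^γ t)/ω(t) < K`,
expressed through an eventual bound by some `c < K`. -/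
def Pcond (ω : ℝ → ℝ) (γ : ℝ) : Prop :=
  ∃ K : ℝ, 1 < K ∧ ∃ c : ℝ, c < K ∧ ∀ᶠ t : ℝ in Filter.atTop, ω (K ^ γ * t) / ω t ≤ c

/-- The growth index `γ(ω) ∈ [0,+∞]`, with `sup ∅ = 0`. -/
noncomputable def gammaIndex (ω : ℝ → ℝ) : ENNReal :=
  ⨆ γ ∈ {γ : ℝ | 0 < γ ∧ Pcond ω γ}, ENNReal.ofReal γ

/-- Condition `(ω₁)`. -/
def Omega1 (ω : ℝ → ℝ) : Prop :=
  ∃ L : ℝ, 1 ≤ L ∧ ∀ t : ℝ, 0 ≤ t → ω (2 * t) ≤ L * (ω t + 1)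

/-- Condition `(ω₃)`: `log t = o(ω t)` as `t → ∞`. -/
def Omega3 (ω : ℝ → ℝ) : Prop :=
  (fun t : ℝ => Real.log t) =o[Filter.atTop] ω

/-- Condition `(ω₄)`: `t ↦ ω (exp t)` is convex on `ℝ`. -/
def Omega4 (ω : ℝ → ℝ) : Prop :=
  ConvexOn ℝ Set.univ (fun t : ℝ => ω (Real.exp t))

/-- Condition `(ω₅)`: `ω t = o(t)` as `t → ∞`. -/
def Omega5 (ω : ℝ → ℝ) : Prop :=
  ω =o[Filter.atTop] (fun t : ℝ => t)

/-- Condition `(ω_snq)`. -/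
def OmegaSnq (ω : ℝ → ℝ) : Prop :=
  ∃ C : ℝ, 0 < C ∧ ∀ y : ℝ, 0 < y →
    (∫⁻ t in Set.Ioi (1:ℝ), ENNReal.ofReal (ω (y * t) / t ^ 2)) ≤
      ENNReal.ofReal (C * (ω y + 1))

/-- `ω ∈ W₀`: normalized weight function with `(ω₃)` and `(ω₄)`. -/
def InW0 (ω : ℝ → ℝ) : Prop :=
  IsWeightFunction ω ∧ (∀ t ∈ Set.Icc (0:ℝ) 1, ω t = 0) ∧ Omega3 ω ∧ Omega4 ω

/-- The Legendre–Fenchel–Young conjugate `φ*_ω(x) = sup {x y − ω(e^y) : y ≥ 0}`. -/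
noncomputable def phiStar (ω : ℝ → ℝ) (x : ℝ) : ℝ :=
  sSup ((fun y : ℝ => x * y - ω (Real.exp y)) '' Set.Ici 0)

/-- The associated weight matrix `W^l_j = exp((1/l) φ*_ω(l j))`. -/
noncomputable def Wseq (ω : ℝ → ℝ) (l : ℝ) (j : ℕ) : ℝ :=
  Real.exp ((1 / l) * phiStar ω (l * (j : ℝ)))

/-- `w^l_j = W^l_j / j!`. -/
noncomputable def wseq (ω : ℝ → ℝ) (l : ℝ) (j : ℕ) : ℝ :=
  Wseq ω l j / (Nat.factorial j : ℝ)

/-- `h_M(t) = inf_{k ∈ ℕ} M_k t^k`. -/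
noncomputable def hFun (M : ℕ → ℝ) (t : ℝ) : ℝ :=
  ⨅ k : ℕ, M k * t ^ k

/-- The associated function `ω_M(t) = sup_p log (t^p / M_p)` for `t > 0`, `ω_M(0) = 0`. -/
noncomputable def assocWeight (M : ℕ → ℝ) (t : ℝ) : ℝ :=
  if t ≤ 0 then 0 else ⨆ p : ℕ, Real.log (t ^ p / M p)

/-- The upper Legendre conjugate `ω⋆(s) = sup_{t ≥ 0} (ω(t) − s t)`. -/
noncomputable def upperConj (ω : ℝ → ℝ) (s : ℝ) : ℝ :=
  sSup ((fun t : ℝ => ω t - s * t) '' Set.Ici 0)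

/-- `(ω⋆)^ι(t) = ω⋆(1/t)` for `t > 0`, with value `0` at `t = 0`. -/
noncomputable def upperConjIota (ω : ℝ → ℝ) (t : ℝ) : ℝ :=
  if t = 0 then 0 else upperConj ω (1 / t)

/-- The lower Legendre conjugate `(ω^ι)_⋆(t) = inf_{s > 0} (ω(1/s) + t s)`. -/
noncomputable def lowerConjIota (ω : ℝ → ℝ) (t : ℝ) : ℝ :=
  sInf ((fun s : ℝ => ω (1 / s) + t * s) '' Set.Ioi 0)

/-- The unbounded sector `S_γ ⊆ ℂ` of opening `γ π` bisected by direction `0`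
(for `0 < γ < 2` it lies in `ℂ`). -/
def sector (γ : ℝ) : Set ℂ :=
  {z : ℂ | z ≠ 0 ∧ |Complex.arg z| < γ * Real.pi / 2}

/-- `M ∈ LC`: positive, normalized, log-convex, `(M_p)^{1/p} → ∞`. -/
def LCseq (M : ℕ → ℝ) : Prop :=
  (∀ p, 0 < M p) ∧ M 0 = 1 ∧ M 0 ≤ M 1 ∧
  (∀ j : ℕ, 1 ≤ j → M j ^ 2 ≤ M (j - 1) * M (j + 1)) ∧
  Filter.Tendsto (fun p : ℕ => M p ^ ((1 : ℝ) / (p : ℝ))) Filter.atTop Filter.atTop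

/-- The partial derivative `∂_i` of a function on `ℝ^d`. -/
noncomputable def partialDeriv {d : ℕ} (i : Fin d)
    (f : EuclideanSpace ℝ (Fin d) → ℂ) : EuclideanSpace ℝ (Fin d) → ℂ :=
  fun x => fderiv ℝ f x (EuclideanSpace.single i 1)

/-- The iterated partial derivative `∂^j` for a multiindex `j ∈ ℕ^d`. -/
noncomputable def multiDeriv {d : ℕ} (j : Fin d → ℕ)
    (f : EuclideanSpace ℝ (Fin d) → ℂ) : EuclideanSpace ℝ (Fin d) → ℂ :=
  (List.finRange d).foldr (fun i g => (partialDeriv i)^[j i] g) f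

end

lemma IsWeightFunction.nonneg {ω : ℝ → ℝ} (h : IsWeightFunction ω) {t : ℝ} (ht : 0 ≤ t) :
    0 ≤ ω t := by
  have := h.monotoneOn (mem_Ici.2 le_rfl) (mem_Ici.2 ht) ht
  rwa [h.map_zero] at this

lemma phiStar_bddAbove {ω : ℝ → ℝ} (hω : InW0 ω) (x : ℝ) :
    BddAbove ((fun y : ℝ => x * y - ω (Real.exp y)) '' Ici 0) := by
  obtain ⟨hw, -, h3, -⟩ := hω
  have hx : 0 < 1 / (|x| + 1) := by positivity
  obtain ⟨T, hT⟩ := eventually_atTop.1 (h3.bound hx)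
  refine ⟨|x| * |Real.log T|, ?_⟩
  rintro _ ⟨y, hy, rfl⟩
  have hy0 : 0 ≤ y := hy
  have hpos : 0 ≤ ω (Real.exp y) := hw.nonneg (Real.exp_pos y).le
  have hxy : x * y ≤ |x| * y := mul_le_mul_of_nonneg_right (le_abs_self x) hy0
  have habs : 0 ≤ |x| * |Real.log T| := by positivity
  simp only
  rcases le_or_gt T (Real.exp y) with h | h
  · have h1 := hT _ h
    rw [Real.log_exp, Real.norm_of_nonneg hy0, Real.norm_of_nonneg hpos, one_div,
      ← div_eq_inv_mul, le_div_iff₀ (by positivity)] at h1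
    nlinarith [abs_nonneg x]
  · have h1 : y ≤ |Real.log T| :=
      ((Real.lt_log_iff_exp_lt ((Real.exp_pos y).trans h)).2 h).le.trans (le_abs_self _)
    have := mul_le_mul_of_nonneg_left h1 (abs_nonneg x)
    linarith

lemma pow_mul_exp_le_Wseq {ω : ℝ → ℝ} (hω : InW0 ω) {L : ℝ} (hL : 0 < L) (N : ℕ) {y : ℝ}
    (hy : 0 ≤ y) : y ^ N * Real.exp (-(ω y / L)) ≤ Wseq ω L N := by
  have key : ∀ t : ℝ, 0 ≤ t → L * N * t - ω (Real.exp t) ≤ phiStar ω (L * N) := fun t ht =>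
    le_csSup (phiStar_bddAbove hω _) ⟨t, ht, rfl⟩
  unfold Wseq
  rcases le_or_gt 1 y with h | h
  · have hy' : 0 < y := by linarith
    have := key (Real.log y) (Real.log_nonneg h)
    rw [Real.exp_log hy'] at this
    rw [← Real.exp_log (pow_pos hy' N), ← Real.exp_add, Real.exp_le_exp, Real.log_pow]
    rw [one_div, ← div_eq_inv_mul, le_div_iff₀ hL]
    have e : (N * Real.log y + -(ω y / L)) * L = L * N * Real.log y - ω y := by
      field_simp
      ring
    rw [e]; exact this
  · have h0 := key 0 le_rfl
    rw [mul_zero, Real.exp_zero, hω.2.1 1 ⟨zero_le_one, le_rfl⟩, sub_zero] at h0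
    have h1 : y ^ N ≤ 1 := pow_le_one₀ hy h.le
    have h2 : Real.exp (-(ω y / L)) ≤ 1 :=
      Real.exp_le_one_iff.2 (by have := div_nonneg (hω.1.nonneg hy) hL.le; linarith)
    calc y ^ N * Real.exp (-(ω y / L)) ≤ 1 * 1 :=
          mul_le_mul h1 h2 (Real.exp_pos _).le zero_le_one
      _ = 1 := one_mul 1
      _ ≤ _ := Real.one_le_exp (by positivity)

lemma Wseq_le_of_forall {ω : ℝ → ℝ} {L : ℝ} (hL : 0 < L) (N : ℕ) {X : ℝ}
    (h : ∀ y : ℝ, 1 ≤ y → y ^ N * Real.exp (-(ω y / L)) ≤ X) : Wseq ω L N ≤ X := by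
  have hX : 0 < X := (by positivity : (0 : ℝ) < 1 ^ N * Real.exp (-(ω 1 / L))).trans_le (h 1 le_rfl)
  unfold Wseq
  rw [← Real.le_log_iff_exp_le hX, one_div, ← div_eq_inv_mul, div_le_iff₀ hL]
  refine csSup_le ⟨_, 0, self_mem_Ici, rfl⟩ ?_
  rintro _ ⟨t, ht, rfl⟩
  have h1 := h (Real.exp t) (Real.one_le_exp ht)
  rw [← Real.exp_nat_mul, ← Real.exp_add, ← Real.le_log_iff_exp_le hX] at h1
  have h2 := mul_le_mul_of_nonneg_right h1 hL.le
  have e : (N * t + -(ω (Real.exp t) / L)) * L = L * N * t - ω (Real.exp t) := by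
    field_simp
    ring
  rwa [e] at h2

lemma Wseq_pos (ω : ℝ → ℝ) (L : ℝ) (N : ℕ) : 0 < Wseq ω L N := Real.exp_pos _

lemma Wseq_mono {ω : ℝ → ℝ} (hω : InW0 ω) {L L' : ℝ} (hL : 0 < L) (hLL : L ≤ L') (N : ℕ) :
    Wseq ω L N ≤ Wseq ω L' N := by
  refine Wseq_le_of_forall hL N fun y hy => ?_
  refine le_trans ?_ (pow_mul_exp_le_Wseq hω (hL.trans_le hLL) N (zero_le_one.trans hy))
  have := div_le_div_of_nonneg_left (hω.1.nonneg (zero_le_one.trans hy)) hL hLL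
  gcongr

lemma exists_pow_le_linear {c Λ η : ℝ} (hc : 1 < c) (hcΛ : c < Λ) (hη : 0 < η) :
    ∃ C : ℝ, 1 ≤ C ∧ ∀ n : ℕ, c ^ (n + 1) ≤ η * Λ ^ n + C := by
  have h0 : 0 < c := by linarith
  obtain ⟨n₀, hn₀⟩ := exists_pow_lt_of_lt_one (div_pos hη h0)
    ((div_lt_one (h0.trans hcΛ)).2 hcΛ)
  refine ⟨c ^ (n₀ + 1), one_le_pow₀ hc.le, fun n => ?_⟩
  rcases le_total n n₀ with h | h
  · have := pow_le_pow_right₀ hc.le (Nat.succ_le_succ h)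
    have : 0 ≤ η * Λ ^ n := by have := h0.trans hcΛ; positivity
    simp only [Nat.succ_eq_add_one] at *
    linarith
  · have h1 : (c / Λ) ^ n ≤ η / c :=
      (pow_le_pow_of_le_one (by have := h0.trans hcΛ; positivity)
        ((div_le_one (h0.trans hcΛ)).2 hcΛ.le) h).trans hn₀.le
    rw [div_pow, div_le_div_iff₀ (pow_pos (h0.trans hcΛ) n) h0, ← pow_succ] at h1
    have : 0 ≤ c ^ (n₀ + 1) := by positivity
    linarith

/-- A positive monotone function on `[0,∞)` whose values grow by a factor at most `c` when the
argument is multiplied by `Λ`. -/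
structure ScaleGrowth (Ω : ℝ → ℝ) (Λ c : ℝ) : Prop where
  mono : MonotoneOn Ω (Ici 0)
  pos : ∀ t, 0 ≤ t → 0 < Ω t
  one_lt : 1 < c
  one_lt_scale : 1 < Λ
  le : ∀ t, 0 ≤ t → Ω (Λ * t) ≤ c * Ω t

namespace ScaleGrowth

variable {Ω : ℝ → ℝ} {Λ c : ℝ}

lemma iterate (h : ScaleGrowth Ω Λ c) {t : ℝ} (ht : 0 ≤ t) (n : ℕ) :
    Ω (Λ ^ n * t) ≤ c ^ n * Ω t := by
  have h0 : 0 < Λ := by linarith [h.one_lt_scale]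
  have hc : 0 < c := by linarith [h.one_lt]
  induction n with
  | zero => simp
  | succ n ih =>
    calc Ω (Λ ^ (n + 1) * t) = Ω (Λ * (Λ ^ n * t)) := by ring_nf
      _ ≤ c * Ω (Λ ^ n * t) := h.le _ (by positivity)
      _ ≤ c * (c ^ n * Ω t) := by gcongr
      _ = _ := by ring

lemma le_linear (h : ScaleGrowth Ω Λ c) (hcΛ : c < Λ) {η : ℝ} (hη : 0 < η) :
    ∃ C : ℝ, 1 ≤ C ∧ ∀ y, 0 ≤ y → ∀ b, 0 ≤ b → Ω (y * b) ≤ (η * b + C) * Ω y := by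
  obtain ⟨C, hC, hCn⟩ := exists_pow_le_linear h.one_lt hcΛ hη
  refine ⟨C, hC, fun y hy b hb => ?_⟩
  have hΩ := (h.pos y hy).le
  rcases le_total b 1 with hb1 | hb1
  · have h1 : Ω (y * b) ≤ Ω y :=
      h.mono (mem_Ici.2 (by positivity)) hy (mul_le_of_le_one_right hy hb1)
    refine h1.trans (le_mul_of_one_le_left hΩ ?_)
    have : 0 ≤ η * b := by positivity
    linarith
  · have hΛ := h.one_lt_scale
    obtain ⟨n, hn1, hn2⟩ := exists_nat_pow_near hb1 hΛ
    calc Ω (y * b) ≤ Ω (Λ ^ (n + 1) * y) := by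
          apply h.mono (mem_Ici.2 (by positivity)) (mem_Ici.2 (by positivity))
          rw [mul_comm]
          gcongr
      _ ≤ c ^ (n + 1) * Ω y := h.iterate hy _
      _ ≤ (η * Λ ^ n + C) * Ω y := by gcongr; exact hCn n
      _ ≤ _ := by gcongr

end ScaleGrowth

/-- The conjugate `r ↦ sup {Ω (r v) - v : v ≥ 0}`; it is the weight associated with the
quotients of the weight sequences of `Ω` by the factorials. -/
noncomputable def dilationConj (Ω : ℝ → ℝ) (r : ℝ) : ℝ :=
  sSup ((fun v : ℝ => Ω (r * v) - v) '' Ici 0)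

namespace ScaleGrowth

variable {Ω : ℝ → ℝ} {Λ c : ℝ}

lemma dilationConj_bddAbove (h : ScaleGrowth Ω Λ c) (hcΛ : c < Λ) {r : ℝ} (hr : 0 ≤ r) :
    BddAbove ((fun v : ℝ => Ω (r * v) - v) '' Ici 0) := by
  have hp := h.pos r hr
  obtain ⟨C, -, hC⟩ := h.le_linear hcΛ (η := 1 / Ω r) (by positivity)
  refine ⟨C * Ω r, ?_⟩
  rintro _ ⟨v, hv, rfl⟩
  have h1 := hC r hr v hv
  have e : (1 / Ω r * v + C) * Ω r = v + C * Ω r := by field_simp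
  simp only
  linarith

lemma le_dilationConj (h : ScaleGrowth Ω Λ c) (hcΛ : c < Λ) {r v : ℝ} (hr : 0 ≤ r) (hv : 0 ≤ v) :
    Ω (r * v) - v ≤ dilationConj Ω r :=
  le_csSup (h.dilationConj_bddAbove hcΛ hr) ⟨v, hv, rfl⟩

lemma dilationConj_le {r X : ℝ} (hX : ∀ v, 0 ≤ v → Ω (r * v) - v ≤ X) : dilationConj Ω r ≤ X := by
  refine csSup_le ⟨_, 0, self_mem_Ici, rfl⟩ ?_
  rintro _ ⟨v, hv, rfl⟩
  exact hX v hv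

/-- The conjugate weight satisfies a growth condition with the scale divided by `K`. -/
lemma dilationConj_scaleGrowth (h : ScaleGrowth Ω Λ c) {K : ℝ} (hK : c ≤ K) (hKΛ : K < Λ) :
    ScaleGrowth (dilationConj Ω) (Λ / K) c where
  mono := by
    have hcΛ : c < Λ := hK.trans_lt hKΛ
    intro r hr s hs hrs
    have hr' : 0 ≤ r := hr
    refine dilationConj_le fun v hv => le_trans ?_ (h.le_dilationConj hcΛ hs hv)
    have := h.mono (mem_Ici.2 (by positivity : 0 ≤ r * v)) (mem_Ici.2 (mul_nonneg hs hv))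
      (mul_le_mul_of_nonneg_right hrs hv)
    linarith
  pos := fun t ht => by
    have h1 := h.le_dilationConj (hK.trans_lt hKΛ) ht le_rfl
    have h2 := h.pos 0 le_rfl
    rw [mul_zero, sub_zero] at h1
    linarith
  one_lt := h.one_lt
  one_lt_scale := (one_lt_div (by linarith [h.one_lt])).2 hKΛ
  le := fun t ht => by
    have hc : 0 < c := by linarith [h.one_lt]
    have hK0 : 0 < K := by linarith
    refine dilationConj_le fun v hv => ?_
    have h1 := h.le (t * (v / K)) (by positivity)
    have h2 := h.le_dilationConj (hK.trans_lt hKΛ) ht (div_nonneg hv hK0.le)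
    have e : Λ / K * t * v = Λ * (t * (v / K)) := by field_simp
    rw [e]
    have h3 : c * (v / K) ≤ v := by
      rw [← mul_div_assoc, div_le_iff₀ hK0, mul_comm]
      gcongr
    have h4 := mul_le_mul_of_nonneg_left h2 hc.le
    linarith

lemma dilationConj_div_le (h : ScaleGrowth Ω Λ c) (hcΛ : c < Λ) {M : ℝ} (hM : 0 < M) :
    ∃ C : ℝ, 1 ≤ C ∧ ∀ y, 0 ≤ y → dilationConj Ω (M * y / Ω y) ≤ C * Ω y := by
  obtain ⟨C, hC1, hC⟩ := h.le_linear hcΛ (η := 1 / M) (by positivity)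
  refine ⟨C, hC1, fun y hy => dilationConj_le fun v hv => ?_⟩
  have hp := h.pos y hy
  have h1 := hC y hy (M * v / Ω y) (by positivity)
  have e1 : M * y / Ω y * v = y * (M * v / Ω y) := by ring
  have e2 : (1 / M * (M * v / Ω y) + C) * Ω y = v + C * Ω y := by field_simp
  rw [e1]
  linarith

end ScaleGrowth

lemma exists_scaleGrowth {ω : ℝ → ℝ} (hω : InW0 ω) {β : ℝ} (hβ : Pcond ω β) (h1β : 1 < β) :
    ∃ K c D : ℝ, c < K ∧ 0 < D ∧ ScaleGrowth (fun t => ω t + D) (K ^ β) c := by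
  obtain ⟨K, hK, c₀, hc₀, hev⟩ := hβ
  have hw := hω.1
  obtain ⟨T, hT⟩ := eventually_atTop.1
    (hev.and ((hw.tendsto_atTop.eventually_gt_atTop 0).and (eventually_ge_atTop 0)))
  set c := max c₀ ((1 + K) / 2) with hc
  have hcK : c < K := max_lt hc₀ (by linarith)
  have hc1 : 1 < c := lt_of_lt_of_le (by linarith) (le_max_right _ _)
  have hT0 : 0 ≤ T := (hT T le_rfl).2.2
  have hKβ : 0 < K ^ β := Real.rpow_pos_of_pos (by linarith) _
  set D := ω (K ^ β * T) / (c - 1) + 1 with hD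
  have hcD : (c - 1) * D = ω (K ^ β * T) + (c - 1) := by
    have : c - 1 ≠ 0 := by linarith
    rw [hD]; field_simp
  have hn : 0 ≤ ω (K ^ β * T) := hw.nonneg (by positivity)
  have hDpos : 0 < D := by
    have : 0 ≤ ω (K ^ β * T) / (c - 1) := div_nonneg hn (by linarith)
    linarith
  have hKKβ : K < K ^ β := by
    simpa using Real.rpow_lt_rpow_of_exponent_lt hK h1β
  refine ⟨K, c, D, hcK, hDpos, ⟨?_, ?_, hc1, hK.trans hKKβ, ?_⟩⟩
  · intro s hs t ht hst
    have := hw.monotoneOn hs ht hst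
    simpa using this
  · intro t ht
    have := hw.nonneg ht
    linarith
  · intro t ht
    rcases le_total T t with h | h
    · obtain ⟨h1, h2, -⟩ := hT t h
      rw [div_le_iff₀ h2] at h1
      have := mul_le_mul_of_nonneg_right (le_max_left c₀ ((1 + K) / 2)) h2.le
      rw [← hc] at this
      linarith
    · have h1 : ω (K ^ β * t) ≤ ω (K ^ β * T) :=
        hw.monotoneOn (mem_Ici.2 (by positivity)) (mem_Ici.2 (by positivity)) (by gcongr)
      have h2 : 0 ≤ c * ω t := mul_nonneg (by linarith) (hw.nonneg ht)
      linarith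

/-- Geometric factors are absorbed by enlarging the level of the weight sequence. -/
lemma exists_pow_mul_Wseq_le {ω : ℝ → ℝ} (hω : InW0 ω) {D Λ c : ℝ} (hD : 0 < D)
    (h : ScaleGrowth (fun t => ω t + D) Λ c) (hcΛ : c < Λ) {B L : ℝ} (hB : 1 ≤ B) (hL : 0 < L) :
    ∃ L' C : ℝ, 0 < L' ∧ 0 < C ∧ ∀ N : ℕ, B ^ N * Wseq ω L N ≤ C * Wseq ω L' N := by
  obtain ⟨C, hC1, hC⟩ := h.le_linear hcΛ (η := 1) one_pos
  set M := 1 * B + C with hM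
  have hMpos : 0 < M := by linarith
  refine ⟨L * M, Real.exp (D / L), by positivity, Real.exp_pos _, fun N => ?_⟩
  have hBN : 0 < B ^ N := by positivity
  rw [mul_comm, ← le_div_iff₀ hBN]
  refine Wseq_le_of_forall hL N fun y hy => ?_
  have hy0 : 0 ≤ y := zero_le_one.trans hy
  rw [le_div_iff₀ hBN]
  have h1 := pow_mul_exp_le_Wseq hω (L := L * M) (by positivity) N
    (by positivity : 0 ≤ y * B)
  have h2 := hC y hy0 B (by linarith)
  rw [← hM] at h2
  have h3 : -(ω y / L) ≤ D / L + -(ω (y * B) / (L * M)) := by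
    have : ω (y * B) / (L * M) ≤ (ω y + D) / L := by
      rw [div_le_div_iff₀ (by positivity) hL]
      nlinarith
    rw [add_div] at this
    linarith
  calc y ^ N * Real.exp (-(ω y / L)) * B ^ N
      ≤ y ^ N * Real.exp (D / L + -(ω (y * B) / (L * M))) * B ^ N := by gcongr
    _ = Real.exp (D / L) * ((y * B) ^ N * Real.exp (-(ω (y * B) / (L * M)))) := by
        rw [Real.exp_add, mul_pow]; ring
    _ ≤ _ := by gcongr

/-- The factorials improve the bounds furnished by the conjugate weight. -/
lemma factorial_mul_pow_mul_exp_le {ω : ℝ → ℝ} (hω : InW0 ω) {D Λ c : ℝ} (hD : 0 < D)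
    (h : ScaleGrowth (fun t => ω t + D) Λ c) (hcΛ : c < Λ) {δ : ℝ} (hδ : 0 < δ)
    (hδ1 : δ ≤ 1) (N : ℕ) {r : ℝ} (hr : 0 ≤ r) :
    (N.factorial : ℝ) * (r ^ N * Real.exp (-(δ * dilationConj (fun t => ω t + D) r))) ≤
      Real.exp 1 ^ N * Wseq ω (1 / δ) N := by
  have h1 := h.le_dilationConj hcΛ hr (Nat.cast_nonneg N)
  have h2 := pow_mul_exp_le_Wseq hω (L := 1 / δ) (by positivity) N
    (by positivity : 0 ≤ r * N)
  have h3 : (N.factorial : ℝ) ≤ (N : ℝ) ^ N := by exact_mod_cast Nat.factorial_le_pow N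
  have h4 : -(δ * dilationConj (fun t => ω t + D) r) ≤ N + -(ω (r * N) / (1 / δ)) := by
    have h5 := mul_le_mul_of_nonneg_left h1 hδ.le
    have h6 : δ * (N : ℝ) ≤ N := mul_le_of_le_one_left (Nat.cast_nonneg N) hδ1
    have h7 : ω (r * N) / (1 / δ) = δ * ω (r * N) := by field_simp
    rw [h7]
    have : 0 < δ * D := by positivity
    nlinarith
  calc (N.factorial : ℝ) * (r ^ N * Real.exp (-(δ * dilationConj (fun t => ω t + D) r)))
      ≤ (N : ℝ) ^ N * (r ^ N * Real.exp (N + -(ω (r * N) / (1 / δ)))) := by gcongr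
    _ = Real.exp 1 ^ N * ((r * N) ^ N * Real.exp (-(ω (r * N) / (1 / δ)))) := by
        rw [Real.exp_add, ← Real.exp_nat_mul, mul_one, mul_pow]; ring
    _ ≤ _ := by gcongr

section Kernel

lemma normSq_ofReal_add {s : ℝ} {ζ : ℂ} (hs : 0 ≤ s) (hζ : 0 ≤ ζ.re) :
    s ^ 2 + ‖ζ‖ ^ 2 ≤ ‖(s : ℂ) + ζ‖ ^ 2 := by
  rw [Complex.sq_norm, Complex.sq_norm, Complex.normSq_apply, Complex.normSq_apply]
  simp only [Complex.add_re, Complex.ofReal_re, Complex.add_im, Complex.ofReal_im, zero_add]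
  nlinarith [mul_nonneg hs hζ]

lemma norm_mul_div_sq_le_left {s : ℝ} {ζ : ℂ} (hs : 0 < s) (hζ : 0 ≤ ζ.re) :
    ‖ζ * s / ((s : ℂ) + ζ) ^ 2‖ ≤ ‖ζ‖ / s := by
  have h := normSq_ofReal_add hs.le hζ
  have h2 := sq_nonneg ‖ζ‖
  have h3 : 0 < s ^ 2 := by positivity
  rw [norm_div, norm_mul, norm_pow, Complex.norm_real, Real.norm_of_nonneg hs.le,
    div_le_div_iff₀ (by linarith) hs]
  nlinarith [norm_nonneg ζ]

lemma norm_mul_div_sq_le_right {s : ℝ} {ζ : ℂ} (hs : 0 < s) (hζ : 0 ≤ ζ.re) (h0 : 0 < ‖ζ‖) :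
    ‖ζ * s / ((s : ℂ) + ζ) ^ 2‖ ≤ s / ‖ζ‖ := by
  have h := normSq_ofReal_add hs.le hζ
  have h2 := sq_nonneg ‖ζ‖
  have h3 : 0 < s ^ 2 := by positivity
  rw [norm_div, norm_mul, norm_pow, Complex.norm_real, Real.norm_of_nonneg hs.le,
    div_le_div_iff₀ (by linarith) h0]
  nlinarith [norm_nonneg ζ]

lemma re_mul_div_sq (s : ℝ) (ζ : ℂ) :
    (ζ * s / ((s : ℂ) + ζ) ^ 2).re =
      s * (s ^ 2 * ζ.re + ‖ζ‖ ^ 2 * ζ.re + 2 * s * ‖ζ‖ ^ 2) / (‖(s : ℂ) + ζ‖ ^ 2) ^ 2 := by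
  rw [Complex.div_re, ← add_div]
  congr 1
  · rw [Complex.sq_norm, Complex.normSq_apply]
    simp [pow_two]
    ring
  · rw [map_pow, Complex.sq_norm]

lemma re_mul_div_sq_nonneg {s : ℝ} {ζ : ℂ} (hs : 0 ≤ s) (hζ : 0 ≤ ζ.re) :
    0 ≤ (ζ * s / ((s : ℂ) + ζ) ^ 2).re := by
  rw [re_mul_div_sq]
  positivity

lemma le_re_mul_div_sq {s Λ : ℝ} {ζ : ℂ} (hs : 0 < s) (hζ : 0 ≤ ζ.re) (h1 : s ≤ ‖ζ‖)
    (h2 : ‖ζ‖ ≤ Λ * s) (hΛ : 0 < Λ) : 1 / (8 * Λ ^ 2) ≤ (ζ * s / ((s : ℂ) + ζ) ^ 2).re := by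
  have hR : 0 < ‖ζ‖ := hs.trans_le h1
  have hn : ‖(s : ℂ) + ζ‖ ≤ 2 * ‖ζ‖ := by
    refine (norm_add_le _ _).trans ?_
    rw [Complex.norm_real, Real.norm_of_nonneg hs.le]
    linarith
  have hpos : 0 < ‖(s : ℂ) + ζ‖ ^ 2 := by
    have := normSq_ofReal_add hs.le hζ
    have h3 : 0 < s ^ 2 := by positivity
    have := sq_nonneg ‖ζ‖
    linarith
  rw [re_mul_div_sq, div_le_div_iff₀ (by positivity) (by positivity), one_mul]
  have a1 : (‖(s : ℂ) + ζ‖ ^ 2) ^ 2 ≤ ((2 * ‖ζ‖) ^ 2) ^ 2 := by gcongr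
  have a2 : ‖ζ‖ ^ 2 ≤ (Λ * s) ^ 2 := by gcongr
  have a3 : 0 ≤ s * (s ^ 2 * ζ.re + ‖ζ‖ ^ 2 * ζ.re) * (8 * Λ ^ 2) := by positivity
  have a4 := mul_le_mul_of_nonneg_right a2 (sq_nonneg ‖ζ‖)
  nlinarith

/-- A series of rational functions with poles on the negative axis, comparable in the right
half-plane with the weight `σ`. -/
noncomputable def poleSum (σ : ℝ → ℝ) (μ Λ : ℝ) (ζ : ℂ) : ℂ :=
  ∑' i : ℕ, (σ (μ ^ i) : ℂ) * (ζ * (Λ ^ i : ℝ) / (((Λ ^ i : ℝ) : ℂ) + ζ) ^ 2)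

variable {σ : ℝ → ℝ} {μ c Λ : ℝ}

lemma poleSum_term_le (h : ScaleGrowth σ μ c) (hΛ : c < Λ) {ζ : ℂ} (hζ : 0 ≤ ζ.re) (i : ℕ) :
    ‖(σ (μ ^ i) : ℂ) * (ζ * (Λ ^ i : ℝ) / (((Λ ^ i : ℝ) : ℂ) + ζ) ^ 2)‖ ≤
      ‖ζ‖ * σ 1 * (c / Λ) ^ i := by
  have hc := h.one_lt
  have hμ0 : 0 < μ := by linarith [h.one_lt_scale]
  have hσ1 := h.pos 1 zero_le_one
  have hΛ0 : 0 < Λ := by linarith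
  have hp := h.pos (μ ^ i) (by positivity)
  have hit : σ (μ ^ i) ≤ c ^ i * σ 1 := by simpa using h.iterate zero_le_one i
  have h1 := norm_mul_div_sq_le_left (s := Λ ^ i) (by positivity) hζ
  rw [norm_mul, Complex.norm_real, Real.norm_of_nonneg hp.le]
  calc _ ≤ (c ^ i * σ 1) * (‖ζ‖ / Λ ^ i) := by gcongr
    _ = _ := by rw [div_pow]; ring

lemma summable_geometric_quot (h : ScaleGrowth σ μ c) (hΛ : c < Λ) (a : ℝ) :
    Summable fun i : ℕ => a * (c / Λ) ^ i := by
  have hc := h.one_lt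
  exact (summable_geometric_of_lt_one (div_nonneg (by linarith) (by linarith))
    ((div_lt_one (by linarith)).2 hΛ)).mul_left a

lemma summable_poleSum_norm (h : ScaleGrowth σ μ c) (hΛ : c < Λ) {ζ : ℂ} (hζ : 0 ≤ ζ.re) :
    Summable fun i : ℕ =>
      ‖(σ (μ ^ i) : ℂ) * (ζ * (Λ ^ i : ℝ) / (((Λ ^ i : ℝ) : ℂ) + ζ) ^ 2)‖ :=
  Summable.of_nonneg_of_le (fun _ => norm_nonneg _) (poleSum_term_le h hΛ hζ)
    (summable_geometric_quot h hΛ _)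

lemma differentiableOn_poleSum (h : ScaleGrowth σ μ c) (hΛ : c < Λ) :
    DifferentiableOn ℂ (poleSum σ μ Λ) {ζ | 0 < ζ.re} := by
  intro ζ₀ hζ₀
  have hΛ0 : 0 < Λ := by linarith [h.one_lt]
  have hσ : 0 < σ 1 := h.pos 1 zero_le_one
  have hc := h.one_lt
  set U : Set ℂ := {ζ | 0 < ζ.re} ∩ Metric.ball 0 (‖ζ₀‖ + 1) with hU
  have hUo : IsOpen U := (isOpen_lt continuous_const Complex.continuous_re).inter Metric.isOpen_ball
  have hmem : ζ₀ ∈ U := ⟨hζ₀, by simp⟩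
  have hd : DifferentiableOn ℂ (poleSum σ μ Λ) U := by
    refine Complex.differentiableOn_tsum_of_summable_norm
      (summable_geometric_quot h hΛ ((‖ζ₀‖ + 1) * σ 1)) ?_ hUo ?_
    · intro i ζ hζ
      have hne : ((Λ ^ i : ℝ) : ℂ) + ζ ≠ 0 := by
        intro h0
        have h1 := congrArg Complex.re h0
        simp only [Complex.add_re, Complex.ofReal_re, Complex.zero_re] at h1
        have h2 : 0 < Λ ^ i := by positivity
        have h3 : 0 < ζ.re := hζ.1
        linarith
      have : DifferentiableAt ℂ (fun ζ : ℂ =>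
          (σ (μ ^ i) : ℂ) * (ζ * (Λ ^ i : ℝ) / (((Λ ^ i : ℝ) : ℂ) + ζ) ^ 2)) ζ := by
        refine DifferentiableAt.const_mul (DifferentiableAt.div (by fun_prop) (by fun_prop) ?_) _
        exact pow_ne_zero 2 hne
      exact this.differentiableWithinAt
    · intro i ζ hζ
      refine (poleSum_term_le h hΛ (le_of_lt hζ.1) i).trans ?_
      have h1 : ‖ζ‖ ≤ ‖ζ₀‖ + 1 := by simpa using (Metric.mem_ball.1 hζ.2).le
      gcongr
  exact (hd.differentiableAt (hUo.mem_nhds hmem)).differentiableWithinAt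

lemma le_re_poleSum (h : ScaleGrowth σ μ c) (hΛ : c < Λ) {α : ℝ} (hα : 0 < α)
    (hμ : Λ ^ α = μ) {ζ : ℂ} (hζ : 0 ≤ ζ.re) :
    1 / (8 * Λ ^ 2 * c) * σ (‖ζ‖ ^ α) - 1 / (8 * Λ ^ 2 * c) * σ 1 ≤ (poleSum σ μ Λ ζ).re := by
  have hc := h.one_lt
  have hΛ0 : 0 < Λ := by linarith
  have hμ0 : 0 < μ := by linarith [h.one_lt_scale]
  have hs := (summable_poleSum_norm h hΛ hζ).of_norm
  have hre : (poleSum σ μ Λ ζ).re = ∑' i : ℕ,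
      ((σ (μ ^ i) : ℂ) * (ζ * (Λ ^ i : ℝ) / (((Λ ^ i : ℝ) : ℂ) + ζ) ^ 2)).re :=
    Complex.re_tsum hs
  have hterm : ∀ i : ℕ, 0 ≤
      ((σ (μ ^ i) : ℂ) * (ζ * (Λ ^ i : ℝ) / (((Λ ^ i : ℝ) : ℂ) + ζ) ^ 2)).re := fun i => by
    rw [Complex.re_ofReal_mul]
    exact mul_nonneg (h.pos _ (by positivity)).le (re_mul_div_sq_nonneg (by positivity) hζ)
  have hκ : 0 < 1 / (8 * Λ ^ 2 * c) := by positivity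
  rcases le_total ‖ζ‖ 1 with hR | hR
  · have h1 : σ (‖ζ‖ ^ α) ≤ σ 1 := h.mono (mem_Ici.2 (by positivity)) (mem_Ici.2 zero_le_one)
      (Real.rpow_le_one (norm_nonneg _) hR hα.le)
    have h2 := mul_le_mul_of_nonneg_left h1 hκ.le
    have h3 : 0 ≤ (poleSum σ μ Λ ζ).re := hre ▸ tsum_nonneg hterm
    linarith
  · obtain ⟨n, hn1, hn2⟩ := exists_nat_pow_near hR (hc.trans hΛ)
    have hr : ‖ζ‖ ^ α ≤ μ * μ ^ n := by
      rw [← pow_succ', ← hμ, ← Real.rpow_natCast, ← Real.rpow_mul hΛ0.le, mul_comm,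
        Real.rpow_mul hΛ0.le, Real.rpow_natCast]
      exact Real.rpow_le_rpow (norm_nonneg _) hn2.le hα.le
    have h1 : σ (‖ζ‖ ^ α) ≤ c * σ (μ ^ n) :=
      (h.mono (mem_Ici.2 (by positivity)) (mem_Ici.2 (by positivity)) hr).trans
        (h.le _ (by positivity))
    have h2 := le_re_mul_div_sq (s := Λ ^ n) (Λ := Λ) (by positivity) hζ hn1
      (by rw [← pow_succ']; exact hn2.le) hΛ0
    have h3 := (Complex.hasSum_re hs.hasSum).summable.le_tsum n (fun i _ => hterm i)
    rw [← hre, Complex.re_ofReal_mul] at h3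
    have hp := h.pos (μ ^ n) (by positivity)
    have h4 := mul_le_mul_of_nonneg_left h2 hp.le
    have h5 := mul_le_mul_of_nonneg_left h1 hκ.le
    have e : 1 / (8 * Λ ^ 2 * c) * (c * σ (μ ^ n)) = σ (μ ^ n) * (1 / (8 * Λ ^ 2)) := by
      field_simp
    have h6 := mul_pos hκ (h.pos 1 zero_le_one)
    linarith

lemma norm_poleSum_le (h : ScaleGrowth σ μ c) (hΛ : c < Λ) {α : ℝ} (hα : 0 < α)
    (hμ : Λ ^ α = μ) :
    ∃ C : ℝ, 0 < C ∧ ∀ ζ : ℂ, 0 ≤ ζ.re → 0 < ‖ζ‖ →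
      ‖poleSum σ μ Λ ζ‖ ≤ C * (σ (‖ζ‖ ^ α) + 1) := by
  have hc := h.one_lt
  have hΛ0 : 0 < Λ := by linarith
  have hμ0 : 0 < μ := by linarith [h.one_lt_scale]
  have hσ1 : 0 < σ 1 := h.pos 1 zero_le_one
  set S := ∑' i : ℕ, (c / Λ) ^ i with hS
  have hgeo : Summable fun i : ℕ => (c / Λ) ^ i := by
    simpa using summable_geometric_quot h hΛ 1
  have hS0 : 0 ≤ S := tsum_nonneg fun i => by positivity
  have hΛ1 : 0 < Λ - 1 := by linarith
  refine ⟨Λ / (Λ - 1) + c * S + σ 1 * S, by positivity, fun ζ hζ hR => ?_⟩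
  have hσR : 0 < σ (‖ζ‖ ^ α) := h.pos _ (by positivity)
  have hsum := summable_poleSum_norm h hΛ hζ
  have hle : ‖poleSum σ μ Λ ζ‖ ≤ _ := norm_tsum_le_tsum_norm hsum
  have htail : ∀ n : ℕ, ‖ζ‖ ≤ Λ ^ n →
      ∑' i : ℕ, ‖(σ (μ ^ (i + n)) : ℂ) *
        (ζ * (Λ ^ (i + n) : ℝ) / (((Λ ^ (i + n) : ℝ) : ℂ) + ζ) ^ 2)‖ ≤ σ (μ ^ n) * S := by
    intro n hn
    rw [hS, ← tsum_mul_left]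
    refine Summable.tsum_le_tsum (fun i => ?_) ((summable_nat_add_iff n).2 hsum)
      (hgeo.mul_left _)
    have h1 := norm_mul_div_sq_le_left (s := Λ ^ (i + n)) (by positivity) hζ
    have h2 : σ (μ ^ (i + n)) ≤ c ^ i * σ (μ ^ n) := by
      rw [pow_add]; exact h.iterate (by positivity) i
    have h3 : ‖ζ‖ / Λ ^ (i + n) ≤ 1 / Λ ^ i := by
      rw [div_le_div_iff₀ (by positivity) (by positivity), pow_add, one_mul, mul_comm]
      gcongr
    have hp := h.pos (μ ^ n) (by positivity)
    rw [norm_mul, Complex.norm_real, Real.norm_of_nonneg (h.pos _ (by positivity)).le]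
    calc _ ≤ (c ^ i * σ (μ ^ n)) * (1 / Λ ^ i) :=
          mul_le_mul h2 (h1.trans h3) (norm_nonneg _) (by positivity)
      _ = _ := by rw [div_pow]; ring
  rcases lt_or_ge ‖ζ‖ 1 with hR1 | hR1
  · have h0 := htail 0 (by simpa using hR1.le)
    simp only [add_zero, pow_zero] at h0
    have : 0 ≤ (Λ / (Λ - 1) + c * S) * (σ (‖ζ‖ ^ α) + 1) + σ 1 * S * σ (‖ζ‖ ^ α) := by positivity
    linarith
  · obtain ⟨m, hm1, hm2⟩ := exists_nat_pow_near hR1 (hc.trans hΛ)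
    have hbm : σ (μ ^ m) ≤ σ (‖ζ‖ ^ α) := by
      refine h.mono (mem_Ici.2 (by positivity)) (mem_Ici.2 (by positivity)) ?_
      rw [← hμ, ← Real.rpow_natCast, ← Real.rpow_mul hΛ0.le, mul_comm,
        Real.rpow_mul hΛ0.le, Real.rpow_natCast]
      exact Real.rpow_le_rpow (by positivity) hm1 hα.le
    have hpm := h.pos (μ ^ m) (by positivity)
    have h1 := htail (m + 1) hm2.le
    have h2 : σ (μ ^ (m + 1)) ≤ c * σ (‖ζ‖ ^ α) := by
      rw [pow_succ']
      exact (h.le _ (by positivity)).trans (by gcongr)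
    have h3 : ∑ i ∈ Finset.range (m + 1), ‖(σ (μ ^ i) : ℂ) *
        (ζ * (Λ ^ i : ℝ) / (((Λ ^ i : ℝ) : ℂ) + ζ) ^ 2)‖ ≤ Λ / (Λ - 1) * σ (‖ζ‖ ^ α) := by
      have h4 : ∀ i ∈ Finset.range (m + 1), ‖(σ (μ ^ i) : ℂ) *
          (ζ * (Λ ^ i : ℝ) / (((Λ ^ i : ℝ) : ℂ) + ζ) ^ 2)‖ ≤ σ (‖ζ‖ ^ α) / Λ ^ m * Λ ^ i := by
        intro i hi
        have hi' : i ≤ m := Nat.lt_succ_iff.1 (Finset.mem_range.1 hi)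
        have h5 := norm_mul_div_sq_le_right (s := Λ ^ i) (by positivity) hζ hR
        have h6 : σ (μ ^ i) ≤ σ (μ ^ m) :=
          h.mono (mem_Ici.2 (by positivity)) (mem_Ici.2 (by positivity))
            (pow_le_pow_right₀ h.one_lt_scale.le hi')
        have h7 : Λ ^ i / ‖ζ‖ ≤ Λ ^ i / Λ ^ m := by gcongr
        rw [norm_mul, Complex.norm_real, Real.norm_of_nonneg (h.pos _ (by positivity)).le]
        calc _ ≤ σ (‖ζ‖ ^ α) * (Λ ^ i / Λ ^ m) :=
              mul_le_mul (h6.trans hbm) (h5.trans h7) (norm_nonneg _) hσR.le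
          _ = _ := by ring
      refine (Finset.sum_le_sum h4).trans ?_
      rw [← Finset.mul_sum, geom_sum_eq (by linarith)]
      have h8 : (Λ ^ (m + 1) - 1) / (Λ - 1) ≤ Λ ^ (m + 1) / (Λ - 1) := by gcongr; linarith
      calc σ (‖ζ‖ ^ α) / Λ ^ m * ((Λ ^ (m + 1) - 1) / (Λ - 1))
          ≤ σ (‖ζ‖ ^ α) / Λ ^ m * (Λ ^ (m + 1) / (Λ - 1)) := by gcongr
        _ = _ := by rw [pow_succ]; field_simp
    rw [← hsum.sum_add_tsum_nat_add (m + 1)] at hle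
    have h9 := mul_le_mul_of_nonneg_right h2 hS0
    have : 0 ≤ Λ / (Λ - 1) + c * S + σ 1 * S + σ 1 * S * σ (‖ζ‖ ^ α) := by positivity
    linarith

lemma poleSum_ofReal (x : ℝ) : ∃ y : ℝ, poleSum σ μ Λ x = y :=
  ⟨∑' i : ℕ, σ (μ ^ i) * (x * Λ ^ i / (Λ ^ i + x) ^ 2), by
    rw [poleSum, Complex.ofReal_tsum]
    push_cast
    rfl⟩

end Kernel

section Sector

variable {α γ : ℝ}

lemma sector_subset_slitPlane (hα : α < 2) : sector α ⊆ Complex.slitPlane := by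
  intro z hz
  rw [Complex.mem_slitPlane_iff_arg]
  refine ⟨fun h => ?_, hz.1⟩
  have h1 := hz.2
  rw [h, abs_of_pos Real.pi_pos] at h1
  nlinarith [Real.pi_pos]

lemma isOpen_sector (hα : α < 2) : IsOpen (sector α) := by
  have h : sector α = Complex.slitPlane ∩ (fun z => |Complex.arg z|) ⁻¹' Iio (α * Real.pi / 2) := by
    ext z
    exact ⟨fun hz => ⟨sector_subset_slitPlane hα hz, hz.2⟩,
      fun hz => ⟨Complex.slitPlane_ne_zero hz.1, hz.2⟩⟩
  rw [h]
  refine ContinuousOn.isOpen_inter_preimage (fun z hz => ?_) Complex.isOpen_slitPlane isOpen_Iio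
  exact (Complex.continuousAt_arg hz).abs.continuousWithinAt

lemma ofReal_mem_sector (hα : 0 < α) {x : ℝ} (hx : 0 < x) : (x : ℂ) ∈ sector α := by
  refine ⟨Complex.ofReal_ne_zero.2 hx.ne', ?_⟩
  rw [Complex.arg_ofReal_of_nonneg hx.le, abs_zero]
  have := Real.pi_pos
  positivity

lemma ofReal_mul_mem_sector {x : ℝ} (hx : 0 < x) {z : ℂ} (hz : z ∈ sector α) :
    (x : ℂ) * z ∈ sector α :=
  ⟨mul_ne_zero (Complex.ofReal_ne_zero.2 hx.ne') hz.1, by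
    rw [Complex.arg_real_mul z hx]; exact hz.2⟩

lemma inv_mem_sector {z : ℂ} (hz : z ∈ sector α) : z⁻¹ ∈ sector α :=
  ⟨inv_ne_zero hz.1, by rw [Complex.abs_arg_inv]; exact hz.2⟩

lemma sector_mono (h : γ ≤ α) : sector γ ⊆ sector α := fun z hz => ⟨hz.1, hz.2.trans_le (by
  have := Real.pi_pos
  gcongr)⟩

lemma isPreconnected_sector (hα : α < 2) : IsPreconnected (sector α) := by
  have h : sector α =
      Complex.exp '' (Complex.im ⁻¹' Ioo (-(α * Real.pi / 2)) (α * Real.pi / 2)) := by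
    ext z
    constructor
    · intro hz
      refine ⟨Complex.log z, ?_, Complex.exp_log hz.1⟩
      rw [mem_preimage, Complex.log_im]
      exact abs_lt.1 hz.2
    · rintro ⟨u, hu, rfl⟩
      have h1 : |u.im| < α * Real.pi / 2 := abs_lt.2 hu
      refine ⟨Complex.exp_ne_zero u, ?_⟩
      have h2 : α * Real.pi / 2 < Real.pi := by nlinarith [Real.pi_pos]
      have h3 := abs_lt.1 (h1.trans h2)
      have h4 : (Complex.exp u).arg = u.im := by
        rw [← Complex.log_im, Complex.log_exp h3.1 h3.2.le]
      rwa [h4]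
  rw [h]
  refine IsPreconnected.image ?_ _ Complex.continuous_exp.continuousOn
  exact ((convex_Ioo _ _).linear_preimage Complex.imLm).isPreconnected

lemma exists_closedBall_subset_sector (h : γ < α) (hγ : 0 < γ) (hα : α < 2) :
    ∃ ρ : ℝ, 0 < ρ ∧ ∀ z ∈ sector γ, Metric.closedBall z (ρ * ‖z‖) ⊆ sector α := by
  have hpi := Real.pi_pos
  have h1 : (1 : ℂ) ∈ sector (α - γ) := by
    simpa using ofReal_mem_sector (sub_pos.2 h) one_pos
  obtain ⟨ρ, hρ, hball⟩ := Metric.nhds_basis_closedBall.mem_iff.1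
    ((isOpen_sector (α := α - γ) (by linarith)).mem_nhds h1)
  refine ⟨ρ, hρ, fun z hz u hu => ?_⟩
  have hz0 : 0 < ‖z‖ := norm_pos_iff.2 hz.1
  have hq : u / z ∈ sector (α - γ) := by
    apply hball
    rw [Metric.mem_closedBall, dist_eq_norm] at hu ⊢
    have : u / z - 1 = (u - z) / z := by field_simp [hz.1]
    rw [this, norm_div, div_le_iff₀ hz0]
    exact hu
  have e : u = z * (u / z) := by field_simp [hz.1]
  have h2 : |z.arg| + |(u / z).arg| < α * Real.pi / 2 := by
    have := add_lt_add hz.2 hq.2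
    linarith
  have h3 : |z.arg + (u / z).arg| < α * Real.pi / 2 := (abs_add_le _ _).trans_lt h2
  have h4 : α * Real.pi / 2 < Real.pi := by nlinarith
  have h5 := abs_lt.1 (h3.trans h4)
  rw [e]
  refine ⟨mul_ne_zero hz.1 hq.1, ?_⟩
  rw [Complex.arg_mul hz.1 hq.1 ⟨h5.1, h5.2.le⟩]
  exact h3

end Sector

section Asymptotic

variable {α γ : ℝ} {f : ℂ → ℂ} {a : ℕ → ℂ} {G : ℕ → ℝ}

lemma iteratedDeriv_sum_mul_pow (a : ℕ → ℂ) (N n : ℕ) (z : ℂ) :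
    iteratedDeriv n (fun z => ∑ q ∈ Finset.range N, a q * z ^ q) z =
      ∑ q ∈ Finset.range N, a q * (q.descFactorial n * z ^ (q - n)) := by
  rw [iteratedDeriv_fun_sum (fun q _ => by fun_prop)]
  refine Finset.sum_congr rfl fun q _ => ?_
  rw [iteratedDeriv_const_mul_field]
  congr 1
  exact iteratedDeriv_pow q n

lemma iteratedDeriv_sum_mul_pow_eq_zero (a : ℕ → ℂ) {N n : ℕ} (h : N ≤ n) (z : ℂ) :
    iteratedDeriv n (fun z => ∑ q ∈ Finset.range N, a q * z ^ q) z = 0 := by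
  rw [iteratedDeriv_sum_mul_pow]
  refine Finset.sum_eq_zero fun q hq => ?_
  rw [Nat.descFactorial_eq_zero_iff_lt.2 ((Finset.mem_range.1 hq).trans_le h)]
  simp

lemma iteratedDeriv_sum_mul_pow_self (a : ℕ → ℂ) (n : ℕ) (z : ℂ) :
    iteratedDeriv n (fun z => ∑ q ∈ Finset.range (n + 1), a q * z ^ q) z = n.factorial * a n := by
  rw [iteratedDeriv_sum_mul_pow, Finset.sum_range_succ, Finset.sum_eq_zero, zero_add]
  · simp [Nat.descFactorial_self, mul_comm]
  · intro q hq
    rw [Nat.descFactorial_eq_zero_iff_lt.2 (Finset.mem_range.1 hq)]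
    simp

/-- Cauchy estimates for the remainders of an asymptotic expansion in a larger sector. -/
lemma norm_iteratedDeriv_sub_le {ρ : ℝ} (hρ : 0 < ρ) (hα : α < 2)
    (hball : ∀ z ∈ sector γ, Metric.closedBall z (ρ * ‖z‖) ⊆ sector α)
    (hf : DifferentiableOn ℂ f (sector α))
    (hfG : ∀ z ∈ sector α, ∀ N : ℕ,
      ‖f z - ∑ q ∈ Finset.range N, a q * z ^ q‖ ≤ G N * ‖z‖ ^ N)
    {z : ℂ} (hz : z ∈ sector γ) (n N : ℕ) :
    ‖iteratedDeriv n f z - iteratedDeriv n (fun z => ∑ q ∈ Finset.range N, a q * z ^ q) z‖ ≤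
      n.factorial * (G N * ((1 + ρ) * ‖z‖) ^ N) / (ρ * ‖z‖) ^ n := by
  have hz0 : 0 < ‖z‖ := norm_pos_iff.2 hz.1
  have hzα : z ∈ sector α := hball z hz (Metric.mem_closedBall_self (by positivity))
  have hP : Differentiable ℂ (fun z : ℂ => ∑ q ∈ Finset.range N, a q * z ^ q) := by fun_prop
  have hfz : ContDiffAt ℂ n f z :=
    (hf.analyticAt ((isOpen_sector hα).mem_nhds hzα)).contDiffAt
  have hPz : ContDiffAt ℂ n (fun z : ℂ => ∑ q ∈ Finset.range N, a q * z ^ q) z := by fun_prop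
  rw [← iteratedDeriv_sub hfz hPz]
  have hG : 0 ≤ G N := by
    have h1 := (norm_nonneg _).trans (hfG z hzα N)
    exact nonneg_of_mul_nonneg_left h1 (by positivity)
  refine Complex.norm_iteratedDeriv_le_of_forall_mem_sphere_norm_le n (by positivity) ?_ ?_
  · refine DifferentiableOn.diffContOnCl ?_
    rw [closure_ball _ (by positivity)]
    exact (hf.mono (hball z hz)).sub hP.differentiableOn
  · intro u hu
    refine (hfG u (hball z hz (Metric.sphere_subset_closedBall hu)) N).trans ?_
    have h1 : ‖u‖ ≤ (1 + ρ) * ‖z‖ := by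
      have h2 : ‖u - z‖ = ρ * ‖z‖ := by simpa [dist_eq_norm] using hu
      have h3 := norm_le_norm_add_norm_sub' u z
      linarith
    gcongr

lemma norm_iteratedDeriv_le {ρ : ℝ} (hρ : 0 < ρ) (hα : α < 2)
    (hball : ∀ z ∈ sector γ, Metric.closedBall z (ρ * ‖z‖) ⊆ sector α)
    (hf : DifferentiableOn ℂ f (sector α))
    (hfG : ∀ z ∈ sector α, ∀ N : ℕ,
      ‖f z - ∑ q ∈ Finset.range N, a q * z ^ q‖ ≤ G N * ‖z‖ ^ N)
    {z : ℂ} (hz : z ∈ sector γ) (n : ℕ) :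
    ‖iteratedDeriv n f z‖ ≤ n.factorial * G n * ((1 + ρ) / ρ) ^ n := by
  have hz0 : 0 < ‖z‖ := norm_pos_iff.2 hz.1
  have h := norm_iteratedDeriv_sub_le hρ hα hball hf hfG hz n n
  rw [iteratedDeriv_sum_mul_pow_eq_zero a le_rfl, sub_zero] at h
  refine h.trans_eq ?_
  rw [mul_pow, mul_pow, div_pow]
  field_simp

lemma tendsto_iteratedDeriv {ρ : ℝ} (hρ : 0 < ρ) (hα : α < 2)
    (hball : ∀ z ∈ sector γ, Metric.closedBall z (ρ * ‖z‖) ⊆ sector α)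
    (hf : DifferentiableOn ℂ f (sector α))
    (hfG : ∀ z ∈ sector α, ∀ N : ℕ,
      ‖f z - ∑ q ∈ Finset.range N, a q * z ^ q‖ ≤ G N * ‖z‖ ^ N) (n : ℕ) :
    Tendsto (iteratedDeriv n f) (nhdsWithin 0 (sector γ)) (nhds (n.factorial * a n)) := by
  rw [tendsto_iff_norm_sub_tendsto_zero]
  set Q := n.factorial * (G (n + 1) * (1 + ρ) ^ (n + 1)) / ρ ^ n with hQ
  have hlim : Tendsto (fun z : ℂ => Q * ‖z‖) (nhdsWithin 0 (sector γ)) (nhds 0) := by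
    have : Tendsto (fun z : ℂ => Q * ‖z‖) (nhds 0) (nhds (Q * ‖(0 : ℂ)‖)) :=
      (continuous_const.mul continuous_norm).tendsto 0
    rw [norm_zero, mul_zero] at this
    exact this.mono_left nhdsWithin_le_nhds
  refine squeeze_zero' (Eventually.of_forall fun _ => norm_nonneg _) ?_ hlim
  filter_upwards [self_mem_nhdsWithin] with z hz
  have hz0 : 0 < ‖z‖ := norm_pos_iff.2 hz.1
  have h := norm_iteratedDeriv_sub_le hρ hα hball hf hfG hz n (n + 1)
  rw [iteratedDeriv_sum_mul_pow_self] at h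
  refine h.trans_eq ?_
  rw [hQ, mul_pow, mul_pow, pow_succ ‖z‖]
  field_simp

end Asymptotic

/-- A holomorphic kernel on a sector, decaying faster than every power at infinity and at worst
bounded at the origin, with explicit constants `E`. -/
structure MomentKernel (k : ℂ → ℂ) (α : ℝ) (E : ℕ → ℝ) : Prop where
  pos : 0 < α
  lt_two : α < 2
  differentiableOn : DifferentiableOn ℂ k (sector α)
  bound : ∀ w ∈ sector α, ∀ N : ℕ, ‖k w‖ * (‖w‖ ^ N * (1 + ‖w‖ ^ 2)) ≤ E N

/-- The moment of order `p`, over the set `s`, of the kernel `k` along the ray through `w`. -/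
noncomputable def rayMoment (k : ℂ → ℂ) (p : ℕ) (s : Set ℝ) (w : ℂ) : ℂ :=
  ∫ x in s, k (x * w) * (x : ℂ) ^ p

lemma integrable_inv_one_add_mul_sq {r : ℝ} (hr : 0 < r) :
    Integrable fun x : ℝ => (1 + (r * x) ^ 2)⁻¹ :=
  integrable_inv_one_add_sq.comp_mul_left' hr.ne'

lemma integral_Ioi_inv_one_add_mul_sq {r : ℝ} (hr : 0 < r) :
    ∫ x in Ioi (0 : ℝ), (1 + (r * x) ^ 2)⁻¹ = r⁻¹ * (Real.pi / 2) := by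
  rw [integral_comp_mul_left_Ioi (fun x => (1 + x ^ 2)⁻¹) 0 hr]
  simp

namespace MomentKernel

variable {k : ℂ → ℂ} {α : ℝ} {E : ℕ → ℝ} {w : ℂ} {s : Set ℝ}

lemma nonneg (h : MomentKernel k α E) (N : ℕ) : 0 ≤ E N := by
  have h1 := h.bound 1 (by simpa using ofReal_mem_sector h.pos one_pos) N
  exact le_trans (by positivity) h1

lemma norm_mul_pow_le (h : MomentKernel k α E) (hw : w ∈ sector α) {r : ℝ} (hr : 0 < r)
    (hrw : r ≤ ‖w‖) {x : ℝ} (hx : 0 < x) {p N : ℕ} (hxp : x ^ p ≤ x ^ N) :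
    ‖k (x * w) * (x : ℂ) ^ p‖ ≤ E N / r ^ N * (1 + (r * x) ^ 2)⁻¹ := by
  have h1 := h.bound _ (ofReal_mul_mem_sector hx hw) N
  have e : ‖(x : ℂ) * w‖ = x * ‖w‖ := by
    rw [norm_mul, Complex.norm_real, Real.norm_of_nonneg hx.le]
  rw [e] at h1
  rw [norm_mul, norm_pow, Complex.norm_real, Real.norm_of_nonneg hx.le, ← div_eq_mul_inv, div_div,
    le_div_iff₀ (by positivity)]
  refine le_trans ?_ h1
  calc ‖k (x * w)‖ * x ^ p * (r ^ N * (1 + (r * x) ^ 2))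
      ≤ ‖k (x * w)‖ * x ^ N * (‖w‖ ^ N * (1 + (‖w‖ * x) ^ 2)) := by gcongr
    _ = _ := by ring

lemma continuousOn_integrand (h : MomentKernel k α E) (hw : w ∈ sector α) (p : ℕ) :
    ContinuousOn (fun x : ℝ => k (x * w) * (x : ℂ) ^ p) (Ioi 0) := by
  refine ContinuousOn.mul (h.differentiableOn.continuousOn.comp (by fun_prop) ?_) (by fun_prop)
  exact fun x hx => ofReal_mul_mem_sector hx hw

lemma integrableOn (h : MomentKernel k α E) (hw : w ∈ sector α) (p : ℕ) :
    IntegrableOn (fun x : ℝ => k (x * w) * (x : ℂ) ^ p) (Ioi 0) := by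
  have hw0 : 0 < ‖w‖ := norm_pos_iff.2 hw.1
  refine Integrable.mono'
    (((integrable_inv_one_add_mul_sq hw0).const_mul (E p / ‖w‖ ^ p)).integrableOn)
    ((h.continuousOn_integrand hw p).aestronglyMeasurable measurableSet_Ioi)
    ((ae_restrict_iff' measurableSet_Ioi).2 (ae_of_all _ fun x hx => ?_))
  exact h.norm_mul_pow_le hw hw0 le_rfl hx le_rfl

lemma norm_rayMoment_le (h : MomentKernel k α E) (hw : w ∈ sector α) (hs : MeasurableSet s)
    (hs0 : s ⊆ Ioi 0) {p N : ℕ} (hsp : ∀ x ∈ s, x ^ p ≤ x ^ N) :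
    ‖rayMoment k p s w‖ ≤ E N / ‖w‖ ^ N * (‖w‖⁻¹ * (Real.pi / 2)) := by
  have hw0 : 0 < ‖w‖ := norm_pos_iff.2 hw.1
  have hi := (integrable_inv_one_add_mul_sq hw0).const_mul (E N / ‖w‖ ^ N)
  have hE := h.nonneg N
  calc ‖rayMoment k p s w‖ ≤ ∫ x in s, E N / ‖w‖ ^ N * (1 + (‖w‖ * x) ^ 2)⁻¹ := by
        refine norm_integral_le_of_norm_le hi.integrableOn
          ((ae_restrict_iff' hs).2 (ae_of_all _ fun x hx => ?_))
        exact h.norm_mul_pow_le hw hw0 le_rfl (hs0 hx) (hsp x hx)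
    _ ≤ ∫ x in Ioi (0 : ℝ), E N / ‖w‖ ^ N * (1 + (‖w‖ * x) ^ 2)⁻¹ := by
        refine setIntegral_mono_set hi.integrableOn (ae_of_all _ fun x => ?_)
          (Eventually.of_forall hs0)
        positivity
    _ = _ := by rw [integral_const_mul, integral_Ioi_inv_one_add_mul_sq hw0]

lemma differentiableAt_rayMoment (h : MomentKernel k α E) (hs : MeasurableSet s)
    (hs0 : s ⊆ Ioi 0) (p : ℕ) (hw : w ∈ sector α) :
    DifferentiableAt ℂ (rayMoment k p s) w := by
  have hw0 : 0 < ‖w‖ := norm_pos_iff.2 hw.1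
  have hopen := isOpen_sector h.lt_two
  obtain ⟨ε, hε, hball⟩ := Metric.nhds_basis_closedBall.mem_iff.1 (hopen.mem_nhds hw)
  set ρ := min (ε / 2) (‖w‖ / 4) with hρ
  have hρ0 : 0 < ρ := by positivity
  have hρε : ρ ≤ ε / 2 := min_le_left _ _
  have hρw : ρ ≤ ‖w‖ / 4 := min_le_right _ _
  have hmem : ∀ u ∈ Metric.ball w ρ, ∀ v ∈ Metric.closedBall u ρ,
      v ∈ sector α ∧ ‖w‖ / 2 ≤ ‖v‖ := by
    intro u hu v hv
    have h1 : dist v w ≤ 2 * ρ := by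
      have := dist_triangle v u w
      have h2 := Metric.mem_ball.1 hu
      have h3 := Metric.mem_closedBall.1 hv
      linarith
    refine ⟨hball (Metric.mem_closedBall.2 (by linarith)), ?_⟩
    have h4 := norm_le_norm_add_norm_sub v w
    rw [← dist_eq_norm] at h4
    linarith
  have hderiv : ∀ x ∈ s, ∀ u ∈ sector α, HasDerivAt (fun u : ℂ => k (x * u) * (x : ℂ) ^ p)
      (deriv k (x * u) * x * (x : ℂ) ^ p) u := by
    intro x hx u hu
    have h1 : HasDerivAt k (deriv k (x * u)) (x * u) :=
      (h.differentiableOn.differentiableAt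
        (hopen.mem_nhds (ofReal_mul_mem_sector (hs0 hx) hu))).hasDerivAt
    have h2 : HasDerivAt (fun u : ℂ => (x : ℂ) * u) x u := by
      simpa using (hasDerivAt_id u).const_mul (x : ℂ)
    exact (h1.comp u h2).mul_const _
  have hr : 0 < ‖w‖ / 2 := by positivity
  refine (hasDerivAt_integral_of_dominated_loc_of_deriv_le (μ := volume.restrict s)
    (F := fun (u : ℂ) (x : ℝ) => k (x * u) * (x : ℂ) ^ p)
    (F' := fun (u : ℂ) (x : ℝ) => deriv k (x * u) * x * (x : ℂ) ^ p)
    (bound := fun x => E p / (‖w‖ / 2) ^ p * (1 + (‖w‖ / 2 * x) ^ 2)⁻¹ / ρ)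
    (Metric.ball_mem_nhds w hρ0) ?_ ((h.integrableOn hw p).mono_set hs0) ?_ ?_ ?_ ?_).2
    |>.differentiableAt
  · filter_upwards [hopen.mem_nhds hw] with u hu
    exact ((h.continuousOn_integrand hu p).mono hs0).aestronglyMeasurable hs
  · have hc : ContinuousOn (deriv k) (sector α) :=
      (h.differentiableOn.deriv hopen).continuousOn
    refine ContinuousOn.aestronglyMeasurable ?_ hs
    refine ContinuousOn.mul (ContinuousOn.mul (hc.comp (by fun_prop) ?_) (by fun_prop))
      (by fun_prop)
    exact fun x hx => ofReal_mul_mem_sector (hs0 hx) hw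
  · refine (ae_restrict_iff' hs).2 (ae_of_all _ fun x hx u hu => ?_)
    have huα := (hmem u hu u (Metric.mem_closedBall_self hρ0.le)).1
    rw [← (hderiv x hx u huα).deriv]
    refine Complex.norm_deriv_le_of_forall_mem_sphere_norm_le hρ0 ?_ fun v hv => ?_
    · refine DifferentiableOn.diffContOnCl ?_
      rw [closure_ball _ hρ0.ne']
      exact fun v hv => (hderiv x hx v (hmem u hu v hv).1).differentiableAt.differentiableWithinAt
    · obtain ⟨h1, h2⟩ := hmem u hu v (Metric.sphere_subset_closedBall hv)
      exact h.norm_mul_pow_le h1 hr h2 (hs0 hx) le_rfl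
  · exact (((integrable_inv_one_add_mul_sq hr).const_mul _).div_const ρ).integrableOn
  · refine (ae_restrict_iff' hs).2 (ae_of_all _ fun x hx u hu => ?_)
    exact hderiv x hx u (hmem u hu u (Metric.mem_closedBall_self hρ0.le)).1

/-- Rotation of the ray of integration. -/
lemma mul_rayMoment_Ioi (h : MomentKernel k α E) (p : ℕ) (hw : w ∈ sector α) :
    w ^ (p + 1) * rayMoment k p (Ioi 0) w = rayMoment k p (Ioi 0) 1 := by
  set J : ℂ → ℂ := fun w => w ^ (p + 1) * rayMoment k p (Ioi 0) w with hJ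
  have hopen := isOpen_sector h.lt_two
  have hd : ∀ u ∈ sector α, DifferentiableAt ℂ J u := fun u hu =>
    (by fun_prop : DifferentiableAt ℂ (fun u : ℂ => u ^ (p + 1)) u).mul
      (h.differentiableAt_rayMoment measurableSet_Ioi Subset.rfl p hu)
  have hscale : ∀ u : ℂ, ∀ t : ℝ, 0 < t → J (t * u) = J u := by
    intro u t ht
    have h1 := integral_comp_mul_right_Ioi (fun x : ℝ => k (x * u) * (x : ℂ) ^ p) 0 ht
    have h2 : ∫ x in Ioi (0 : ℝ), k (((x * t : ℝ) : ℂ) * u) * ((x * t : ℝ) : ℂ) ^ p =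
        (t : ℂ) ^ p * rayMoment k p (Ioi 0) (t * u) := by
      rw [rayMoment, ← integral_const_mul]
      congr 1 with x
      push_cast
      ring_nf
    rw [h2, zero_mul, Complex.real_smul, Complex.ofReal_inv] at h1
    change _ = (t : ℂ)⁻¹ * rayMoment k p (Ioi 0) u at h1
    have ht' : (t : ℂ) ≠ 0 := Complex.ofReal_ne_zero.2 ht.ne'
    simp only [hJ]
    calc ((t : ℂ) * u) ^ (p + 1) * rayMoment k p (Ioi 0) (t * u)
        = t * u ^ (p + 1) * ((t : ℂ) ^ p * rayMoment k p (Ioi 0) (t * u)) := by ring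
      _ = _ := by rw [h1]; field_simp
  have hzero : EqOn (deriv J) 0 (sector α) := by
    intro u hu
    have h1 : HasDerivAt (fun t : ℂ => t * u) u (1 : ℝ) := by
      simpa using (hasDerivAt_id ((1 : ℝ) : ℂ)).mul_const u
    have h2 : HasDerivAt J (deriv J u) (((1 : ℝ) : ℂ) * u) := by
      simpa using (hd u hu).hasDerivAt
    have h3 : HasDerivAt (fun t : ℝ => J (t * u)) (deriv J u * u) 1 :=
      (HasDerivAt.comp (h₂ := J) ((1 : ℝ) : ℂ) h2 h1).comp_ofReal
    have h4 : (fun t : ℝ => J (t * u)) =ᶠ[nhds 1] fun _ => J u := by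
      filter_upwards [lt_mem_nhds one_pos] with t ht using hscale u t ht
    have h5 := (h3.congr_of_eventuallyEq h4.symm).unique (hasDerivAt_const (1 : ℝ) (J u))
    exact (mul_eq_zero.1 h5).resolve_right hu.1
  have h1 : (1 : ℂ) ∈ sector α := by simpa using ofReal_mem_sector h.pos one_pos
  have := hopen.is_const_of_deriv_eq_zero (isPreconnected_sector h.lt_two)
    (fun u hu => (hd u hu).differentiableWithinAt) hzero hw h1
  simpa [hJ] using this

/-- The normalised truncated moment of order `p` is holomorphic as a function of `z = 1 / w`. -/
lemma differentiableOn_truncated (h : MomentKernel k α E) (p : ℕ) :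
    DifferentiableOn ℂ (fun z : ℂ => z⁻¹ * rayMoment k p (Ioc 0 1) z⁻¹) (sector α) := by
  intro z hz
  have h1 := h.differentiableAt_rayMoment (s := Ioc 0 1) measurableSet_Ioc (fun x hx => hx.1) p
    (inv_mem_sector hz)
  have h2 : DifferentiableAt ℂ (fun z : ℂ => z⁻¹) z := differentiableAt_inv hz.1
  exact (h2.mul (h1.comp z h2)).differentiableWithinAt

lemma norm_truncated_le (h : MomentKernel k α E) {z : ℂ} (hz : z ∈ sector α) {p N : ℕ}
    (hN : N ≤ p) :
    ‖z⁻¹ * rayMoment k p (Ioc 0 1) z⁻¹‖ ≤ Real.pi / 2 * E N * ‖z‖ ^ N := by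
  have hz0 : 0 < ‖z‖ := norm_pos_iff.2 hz.1
  have h1 := h.norm_rayMoment_le (s := Ioc 0 1) (inv_mem_sector hz) measurableSet_Ioc
    (fun x hx => hx.1) (p := p) (N := N) fun x hx => pow_le_pow_of_le_one hx.1.le hx.2 hN
  rw [norm_inv] at h1
  rw [norm_mul, norm_inv]
  calc _ ≤ ‖z‖⁻¹ * (E N / ‖z‖⁻¹ ^ N * (‖z‖⁻¹⁻¹ * (Real.pi / 2))) := by gcongr
    _ = _ := by rw [inv_pow]; field_simp

lemma norm_truncated_sub_le (h : MomentKernel k α E) {z : ℂ} (hz : z ∈ sector α) {p N : ℕ}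
    (hN : p ≤ N) :
    ‖z⁻¹ * rayMoment k p (Ioc 0 1) z⁻¹ - rayMoment k p (Ioi 0) 1 * z ^ p‖ ≤
      Real.pi / 2 * E N * ‖z‖ ^ N := by
  have hz0 : 0 < ‖z‖ := norm_pos_iff.2 hz.1
  have hw := inv_mem_sector hz
  have h1 := h.norm_rayMoment_le (s := Ioi 1) hw measurableSet_Ioi
    (Ioi_subset_Ioi zero_le_one) (p := p) (N := N) fun x hx => pow_le_pow_right₀ (le_of_lt hx) hN
  have h2 : rayMoment k p (Ioi 0) z⁻¹ =
      rayMoment k p (Ioc 0 1) z⁻¹ + rayMoment k p (Ioi 1) z⁻¹ := by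
    have hi := h.integrableOn hw p
    rw [rayMoment, ← Ioc_union_Ioi_eq_Ioi (zero_le_one (α := ℝ))]
    exact setIntegral_union (Ioc_disjoint_Ioi le_rfl) measurableSet_Ioi
      (hi.mono_set fun x hx => hx.1) (hi.mono_set (Ioi_subset_Ioi zero_le_one))
  have h3 : z⁻¹ * rayMoment k p (Ioc 0 1) z⁻¹ - rayMoment k p (Ioi 0) 1 * z ^ p =
      -(z⁻¹ * rayMoment k p (Ioi 1) z⁻¹) := by
    have e : z⁻¹ ^ (p + 1) * z ^ p = z⁻¹ := by
      have := hz.1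
      rw [pow_succ, inv_pow]
      field_simp
    rw [← h.mul_rayMoment_Ioi p hw, mul_right_comm, e, h2]
    ring
  rw [norm_inv] at h1
  rw [h3, norm_neg, norm_mul, norm_inv]
  calc _ ≤ ‖z‖⁻¹ * (E N / ‖z‖⁻¹ ^ N * (‖z‖⁻¹⁻¹ * (Real.pi / 2))) := by gcongr
    _ = _ := by rw [inv_pow]; field_simp

end MomentKernel

section Extension

variable {k : ℂ → ℂ} {α : ℝ} {E : ℕ → ℝ}

/-- The series of truncated moments with coefficients `b`. -/
noncomputable def truncatedSeries (k : ℂ → ℂ) (b : ℕ → ℂ) (z : ℂ) : ℂ :=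
  ∑' p : ℕ, b p * (z⁻¹ * rayMoment k p (Ioc 0 1) z⁻¹)

namespace MomentKernel

variable {b : ℕ → ℂ} {A : ℝ}

lemma norm_truncatedSeries_term_le (h : MomentKernel k α E) (hb : ∀ p, ‖b p‖ ≤ A * (1 / 2) ^ p)
    {z : ℂ} (hz : z ∈ sector α) (p : ℕ) :
    ‖b p * (z⁻¹ * rayMoment k p (Ioc 0 1) z⁻¹)‖ ≤ A * (Real.pi / 2 * E 0) * (1 / 2) ^ p := by
  have h1 := h.norm_truncated_le hz (Nat.zero_le p)
  rw [pow_zero, mul_one] at h1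
  rw [norm_mul]
  calc _ ≤ A * (1 / 2) ^ p * (Real.pi / 2 * E 0) :=
        mul_le_mul (hb p) h1 (norm_nonneg _) ((norm_nonneg _).trans (hb p))
    _ = _ := by ring

lemma summable_truncatedSeries (h : MomentKernel k α E) (hb : ∀ p, ‖b p‖ ≤ A * (1 / 2) ^ p)
    {z : ℂ} (hz : z ∈ sector α) :
    Summable fun p : ℕ => b p * (z⁻¹ * rayMoment k p (Ioc 0 1) z⁻¹) :=
  Summable.of_norm_bounded (summable_geometric_two.mul_left (A * (Real.pi / 2 * E 0)))
    (h.norm_truncatedSeries_term_le hb hz)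

lemma differentiableOn_truncatedSeries (h : MomentKernel k α E)
    (hb : ∀ p, ‖b p‖ ≤ A * (1 / 2) ^ p) :
    DifferentiableOn ℂ (truncatedSeries k b) (sector α) :=
  Complex.differentiableOn_tsum_of_summable_norm
    (summable_geometric_two.mul_left (A * (Real.pi / 2 * E 0)))
    (fun p => (h.differentiableOn_truncated p).const_mul (b p)) (isOpen_sector h.lt_two)
    (fun p _ hz => h.norm_truncatedSeries_term_le hb hz p)

lemma norm_truncatedSeries_sub_le (h : MomentKernel k α E)
    (hb : ∀ p, ‖b p‖ ≤ A * (1 / 2) ^ p) {z : ℂ} (hz : z ∈ sector α) (N : ℕ) :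
    ‖truncatedSeries k b z -
      ∑ p ∈ Finset.range N, b p * rayMoment k p (Ioi 0) 1 * z ^ p‖ ≤
      A * Real.pi * E N * ‖z‖ ^ N := by
  set d : ℕ → ℂ := fun p => if p ∈ Finset.range N then b p * rayMoment k p (Ioi 0) 1 * z ^ p else 0
    with hd
  have hsum : HasSum d (∑ p ∈ Finset.range N, d p) :=
    hasSum_sum_of_ne_finset_zero fun p hp => by simp only [hd, if_neg hp]
  have hsum' : ∑ p ∈ Finset.range N, d p =
      ∑ p ∈ Finset.range N, b p * rayMoment k p (Ioi 0) 1 * z ^ p :=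
    Finset.sum_congr rfl fun p hp => by simp only [hd, if_pos hp]
  rw [hsum'] at hsum
  have hterm : ∀ p : ℕ, ‖b p * (z⁻¹ * rayMoment k p (Ioc 0 1) z⁻¹) - d p‖ ≤
      A * (Real.pi / 2 * E N * ‖z‖ ^ N) * (1 / 2) ^ p := by
    intro p
    have key : ∀ u : ℂ, ‖u‖ ≤ Real.pi / 2 * E N * ‖z‖ ^ N →
        ‖b p * u‖ ≤ A * (Real.pi / 2 * E N * ‖z‖ ^ N) * (1 / 2) ^ p := by
      intro u hu
      rw [norm_mul]
      calc _ ≤ A * (1 / 2) ^ p * (Real.pi / 2 * E N * ‖z‖ ^ N) :=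
            mul_le_mul (hb p) hu (norm_nonneg _) ((norm_nonneg _).trans (hb p))
        _ = _ := by ring
    by_cases hp : p ∈ Finset.range N
    · simp only [hd, if_pos hp]
      have h1 := key _ (h.norm_truncated_sub_le hz (Finset.mem_range.1 hp).le)
      rwa [mul_sub, ← mul_assoc (b p) (rayMoment k p (Ioi 0) 1)] at h1
    · simp only [hd, if_neg hp, sub_zero]
      exact key _ (h.norm_truncated_le hz (by simpa using hp))
  have hdiff := ((h.summable_truncatedSeries hb hz).hasSum.sub hsum).tsum_eq
  rw [truncatedSeries, ← hdiff]
  refine (tsum_of_norm_bounded (hasSum_geometric_two.mul_left _) hterm).trans_eq ?_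
  ring

/-- A moment kernel whose moments dominate a weight sequence yields a linear right inverse of the
Borel map, with control of all the remainders of the asymptotic expansion. -/
lemma exists_linearMap (h : MomentKernel k α E) {m W : ℕ → ℝ} {Q : ℝ} (hm0 : ∀ p, 0 < m p)
    (hm : ∀ p, rayMoment k p (Ioi 0) 1 = m p) (hW0 : ∀ p, 0 < W p)
    (hW : ∀ p, W p ≤ Q * (1 / 2) ^ p * (p.factorial * m p)) :
    ∃ T : (ℕ → ℂ) →ₗ[ℂ] (ℂ → ℂ), ∀ lam : ℕ → ℂ, ∀ A : ℝ, (∀ p, ‖lam p‖ ≤ A * W p) →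
      DifferentiableOn ℂ (T lam) (sector α) ∧ ∀ z ∈ sector α, ∀ N : ℕ,
        ‖T lam z - ∑ q ∈ Finset.range N, lam q / q.factorial * z ^ q‖ ≤
          A * Q * Real.pi * E N * ‖z‖ ^ N := by
  have hcoef : ∀ (lam : ℕ → ℂ) (A : ℝ), (∀ p, ‖lam p‖ ≤ A * W p) →
      ∀ p, ‖lam p / (p.factorial * m p : ℝ)‖ ≤ A * Q * (1 / 2) ^ p := by
    intro lam A hlam p
    have hA : 0 ≤ A := nonneg_of_mul_nonneg_left ((norm_nonneg _).trans (hlam p)) (hW0 p)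
    have hfm : 0 < (p.factorial * m p : ℝ) := mul_pos (by positivity) (hm0 p)
    rw [norm_div, Complex.norm_real, Real.norm_of_nonneg hfm.le, div_le_iff₀ hfm]
    calc _ ≤ A * W p := hlam p
      _ ≤ A * (Q * (1 / 2) ^ p * (p.factorial * m p)) := by gcongr; exact hW p
      _ = _ := by ring
  let V : Submodule ℂ (ℕ → ℂ) :=
    { carrier := {lam | ∃ A : ℝ, ∀ p, ‖lam p‖ ≤ A * W p}
      add_mem' := by
        rintro x y ⟨A, hA⟩ ⟨B, hB⟩
        refine ⟨A + B, fun p => (norm_add_le _ _).trans ?_⟩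
        rw [add_mul]
        exact add_le_add (hA p) (hB p)
      zero_mem' := ⟨0, fun p => by simp⟩
      smul_mem' := by
        rintro a x ⟨A, hA⟩
        refine ⟨‖a‖ * A, fun p => ?_⟩
        rw [Pi.smul_apply, norm_smul, mul_assoc]
        gcongr
        exact hA p }
  classical
  let T₀ : V →ₗ[ℂ] (ℂ → ℂ) :=
    { toFun := fun lam z => if z ∈ sector α then
        truncatedSeries k (fun p => (lam : ℕ → ℂ) p / (p.factorial * m p : ℝ)) z else 0
      map_add' := by
        rintro ⟨x, A, hA⟩ ⟨y, B, hB⟩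
        ext z
        by_cases hz : z ∈ sector α
        · simp only [if_pos hz, Pi.add_apply]
          rw [truncatedSeries, truncatedSeries, truncatedSeries,
            ← (h.summable_truncatedSeries (hcoef x A hA) hz).tsum_add
              (h.summable_truncatedSeries (hcoef y B hB) hz)]
          refine tsum_congr fun p => ?_
          simp only [Submodule.coe_add, Pi.add_apply]
          ring
        · simp [hz]
      map_smul' := by
        rintro a ⟨x, A, hA⟩
        ext z
        by_cases hz : z ∈ sector α
        · simp only [if_pos hz, Pi.smul_apply, RingHom.id_apply, smul_eq_mul]
          rw [truncatedSeries, truncatedSeries, ← tsum_mul_left]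
          refine tsum_congr fun p => ?_
          simp only [Submodule.coe_smul, Pi.smul_apply, smul_eq_mul]
          ring
        · simp [hz] }
  obtain ⟨T, hT⟩ := LinearMap.exists_extend T₀
  refine ⟨T, fun lam A hlam => ?_⟩
  have hb := hcoef lam A hlam
  have hTlam : ∀ z ∈ sector α, T lam z =
      truncatedSeries k (fun p => lam p / (p.factorial * m p : ℝ)) z := by
    intro z hz
    have h1 : T lam = T₀ ⟨lam, A, hlam⟩ := by rw [← hT]; rfl
    rw [h1]
    exact if_pos hz
  refine ⟨(h.differentiableOn_truncatedSeries hb).congr hTlam, fun z hz N => ?_⟩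
  have h1 := h.norm_truncatedSeries_sub_le hb hz N
  rw [hTlam z hz]
  convert h1 using 5 with q
  rw [hm q]
  have h2 : (m q : ℂ) ≠ 0 := Complex.ofReal_ne_zero.2 (hm0 q).ne'
  push_cast
  field_simp

end MomentKernel

end Extension

namespace MomentKernel

variable {k : ℂ → ℂ} {α : ℝ} {E : ℕ → ℝ} {κ : ℝ → ℝ}

lemma integrableOn_real (h : MomentKernel k α E) (hκ : ∀ v : ℝ, 0 < v → k v = κ v) (p : ℕ) :
    IntegrableOn (fun x : ℝ => κ x * x ^ p) (Ioi 0) := by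
  have h1 : (1 : ℂ) ∈ sector α := by simpa using ofReal_mem_sector h.pos one_pos
  refine (IntegrableOn.congr_fun (h.integrableOn h1 p).re (fun x hx => ?_) measurableSet_Ioi)
  have hx0 : 0 < x := hx
  simp only [mul_one, hκ x hx0]
  norm_cast

lemma rayMoment_Ioi_one (hκ : ∀ v : ℝ, 0 < v → k v = κ v) (p : ℕ) :
    rayMoment k p (Ioi 0) 1 = ((∫ x in Ioi (0 : ℝ), κ x * x ^ p : ℝ) : ℂ) := by
  rw [rayMoment, ← integral_complex_ofReal]
  refine setIntegral_congr_fun measurableSet_Ioi fun x hx => ?_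
  have hx0 : 0 < x := hx
  simp only [mul_one, hκ x hx0]
  push_cast
  rfl

/-- The moments are bounded below by the values of the kernel on a dyadic interval. -/
lemma le_moment (h : MomentKernel k α E) (hκ : ∀ v : ℝ, 0 < v → k v = κ v)
    (hκ0 : ∀ v : ℝ, 0 < v → 0 < κ v) {v₀ θ : ℝ} (hv₀ : 0 < v₀) (hθ : 0 ≤ θ)
    (hle : ∀ v ∈ Ioc v₀ (2 * v₀), θ ≤ κ v) (p : ℕ) :
    v₀ * (v₀ ^ p * θ) ≤ ∫ x in Ioi (0 : ℝ), κ x * x ^ p := by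
  have hi := h.integrableOn_real hκ p
  have hsub : Ioc v₀ (2 * v₀) ⊆ Ioi 0 := fun x hx => hv₀.trans hx.1
  calc v₀ * (v₀ ^ p * θ) = ∫ _ in Ioc v₀ (2 * v₀), v₀ ^ p * θ := by
        rw [setIntegral_const, smul_eq_mul, Real.volume_real_Ioc_of_le (by linarith)]
        ring
    _ ≤ ∫ x in Ioc v₀ (2 * v₀), κ x * x ^ p := by
        refine setIntegral_mono_on (integrableOn_const (by simp)) (hi.mono_set hsub)
          measurableSet_Ioc fun x hx => ?_
        have h1 := hle x hx
        have h2 := hx.1.le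
        have h3 := hθ.trans h1
        rw [mul_comm]
        gcongr
    _ ≤ _ := by
        refine setIntegral_mono_set hi
          ((ae_restrict_iff' measurableSet_Ioi).2 (ae_of_all _ fun x hx => ?_))
          (Eventually.of_forall hsub)
        have hx0 : 0 < x := hx
        exact (mul_pos (hκ0 x hx0) (pow_pos hx0 p)).le

end MomentKernel

section ExpKernel

variable {σ : ℝ → ℝ} {μ c Λ α ε : ℝ}

lemma re_cpow_pos (hα : 0 < α) {w : ℂ} (hw : w ∈ sector α) : 0 < (w ^ ((1 / α : ℝ) : ℂ)).re := by
  rw [Complex.cpow_def_of_ne_zero hw.1, Complex.exp_re]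
  refine mul_pos (Real.exp_pos _) (Real.cos_pos_of_mem_Ioo (abs_lt.1 ?_))
  rw [Complex.im_mul_ofReal, Complex.log_im, abs_mul, abs_of_pos (one_div_pos.2 hα), mul_one_div,
    div_lt_iff₀ hα]
  have := hw.2
  linarith

lemma norm_cpow_rpow (hα : 0 < α) (w : ℂ) : ‖w ^ ((1 / α : ℝ) : ℂ)‖ ^ α = ‖w‖ := by
  rw [Complex.norm_cpow_real, ← Real.rpow_mul (norm_nonneg _), one_div_mul_cancel hα.ne',
    Real.rpow_one]

/-- The exponential of the series of poles, transplanted to the sector of opening `α`. -/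
noncomputable def expKernel (σ : ℝ → ℝ) (μ Λ α ε : ℝ) (w : ℂ) : ℂ :=
  Complex.exp (-(ε * poleSum σ μ Λ (w ^ ((1 / α : ℝ) : ℂ))))

lemma differentiableOn_expKernel (h : ScaleGrowth σ μ c) (hΛ : c < Λ) (hα : 0 < α) (hα2 : α < 2) :
    DifferentiableOn ℂ (expKernel σ μ Λ α ε) (sector α) := by
  intro w hw
  have h1 : DifferentiableAt ℂ (fun w : ℂ => w ^ ((1 / α : ℝ) : ℂ)) w :=
    ((hasDerivAt_id w).cpow_const (c := ((1 / α : ℝ) : ℂ))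
      (sector_subset_slitPlane hα2 hw)).differentiableAt
  have h2 : DifferentiableAt ℂ (poleSum σ μ Λ) (w ^ ((1 / α : ℝ) : ℂ)) :=
    (differentiableOn_poleSum h hΛ).differentiableAt
      ((isOpen_lt continuous_const Complex.continuous_re).mem_nhds (re_cpow_pos hα hw))
  have h3 : DifferentiableAt ℂ (fun w : ℂ => poleSum σ μ Λ (w ^ ((1 / α : ℝ) : ℂ))) w :=
    DifferentiableAt.comp (g := poleSum σ μ Λ) w h2 h1
  exact ((h3.const_mul _).neg.cexp).differentiableWithinAt

lemma norm_expKernel_le (h : ScaleGrowth σ μ c) (hΛ : c < Λ) (hα : 0 < α) (hμ : Λ ^ α = μ)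
    (hε : 0 ≤ ε) {w : ℂ} (hw : w ∈ sector α) :
    ‖expKernel σ μ Λ α ε w‖ ≤ Real.exp (ε * (1 / (8 * Λ ^ 2 * c)) * σ 1) *
      Real.exp (-(ε * (1 / (8 * Λ ^ 2 * c)) * σ ‖w‖)) := by
  rw [expKernel, Complex.norm_exp, ← Real.exp_add, Complex.neg_re, Complex.re_ofReal_mul]
  have h1 := le_re_poleSum h hΛ hα hμ (re_cpow_pos hα hw).le
  rw [norm_cpow_rpow hα] at h1
  have h2 := mul_le_mul_of_nonneg_left h1 hε
  apply Real.exp_le_exp.2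
  linarith

lemma exists_expKernel_ofReal (h : ScaleGrowth σ μ c) (hΛ : c < Λ) (hα : 0 < α)
    (hμ : Λ ^ α = μ) :
    ∃ C : ℝ, 0 < C ∧ ∀ ε : ℝ, 0 ≤ ε → ∃ κ : ℝ → ℝ, ∀ v : ℝ, 0 < v →
      expKernel σ μ Λ α ε v = κ v ∧ Real.exp (-(ε * (C * (σ v + 1)))) ≤ κ v := by
  obtain ⟨C, hC0, hC⟩ := norm_poleSum_le h hΛ hα hμ
  choose y hy using poleSum_ofReal (σ := σ) (μ := μ) (Λ := Λ)
  refine ⟨C, hC0, fun ε hε => ⟨fun v => Real.exp (-(ε * y (v ^ (1 / α)))), fun v hv => ?_⟩⟩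
  have e : (v : ℂ) ^ ((1 / α : ℝ) : ℂ) = ((v ^ (1 / α) : ℝ) : ℂ) :=
    (Complex.ofReal_cpow hv.le _).symm
  have hv' : 0 < v ^ (1 / α) := Real.rpow_pos_of_pos hv _
  refine ⟨?_, ?_⟩
  · rw [expKernel, e, hy]
    push_cast
    rfl
  · apply Real.exp_le_exp.2
    have h1 := hC ((v ^ (1 / α) : ℝ) : ℂ) (by simpa using hv'.le) (by simpa using hv'.ne')
    rw [hy, Complex.norm_real, Complex.norm_real, Real.norm_of_nonneg hv'.le,
      ← Real.rpow_mul hv.le, one_div_mul_cancel hα.ne', Real.rpow_one] at h1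
    have h2 := (le_abs_self _).trans h1
    have h3 := mul_le_mul_of_nonneg_left h2 hε
    linarith

end ExpKernel

section Construction

variable {ω : ℝ → ℝ} {D Λ₀ c : ℝ}

/-- Upper bound for the constants of a kernel decaying like the exponential of the conjugate
weight. -/
lemma pow_mul_exp_dilationConj_le (hω : InW0 ω) (hD : 0 < D)
    (h : ScaleGrowth (fun t => ω t + D) Λ₀ c) (hcΛ : c < Λ₀) {δ : ℝ} (hδ : 0 < δ) (hδ1 : δ ≤ 1)
    (N : ℕ) {r : ℝ} (hr : 0 ≤ r) :
    Real.exp (-(2 * δ * dilationConj (fun t => ω t + D) r)) * (r ^ N * (1 + r ^ 2)) ≤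
      (Wseq ω (1 / δ) 0 + Real.exp 1 ^ 2 * Wseq ω (1 / δ) 2) *
        (Real.exp 1 ^ N * Wseq ω (1 / δ) N / N.factorial) := by
  set e := Real.exp (-(δ * dilationConj (fun t => ω t + D) r)) with he
  have h0 := factorial_mul_pow_mul_exp_le hω hD h hcΛ hδ hδ1 0 hr
  have h2 := factorial_mul_pow_mul_exp_le hω hD h hcΛ hδ hδ1 2 hr
  have hN := factorial_mul_pow_mul_exp_le hω hD h hcΛ hδ hδ1 N hr
  rw [← he] at h0 h2 hN
  have hfac : 0 < (N.factorial : ℝ) := by positivity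
  have hN' : r ^ N * e ≤ Real.exp 1 ^ N * Wseq ω (1 / δ) N / N.factorial := by
    rw [le_div_iff₀ hfac, mul_comm]
    exact hN
  simp only [Nat.factorial_zero, Nat.factorial_two, pow_zero, one_mul, Nat.cast_one,
    Nat.cast_ofNat] at h0 h2
  have he0 : 0 < e := Real.exp_pos _
  have hs : e * (1 + r ^ 2) ≤ Wseq ω (1 / δ) 0 + Real.exp 1 ^ 2 * Wseq ω (1 / δ) 2 := by
    have : 0 ≤ r ^ 2 * e := by positivity
    linarith
  have hee : Real.exp (-(2 * δ * dilationConj (fun t => ω t + D) r)) = e * e := by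
    rw [he, ← Real.exp_add]
    congr 1
    ring
  rw [hee]
  calc e * e * (r ^ N * (1 + r ^ 2)) = e * (1 + r ^ 2) * (r ^ N * e) := by ring
    _ ≤ _ := mul_le_mul hs hN' (by positivity) ((by positivity : 0 ≤ e * (1 + r ^ 2)).trans hs)

/-- If the moments are bounded below through the conjugate weight, they dominate the weight
sequence divided by the factorials. -/
lemma exists_Wseq_le_moment (h : ScaleGrowth (fun t => ω t + D) Λ₀ c) (hcΛ : c < Λ₀)
    {l : ℝ} (hl : 0 < l) {m : ℕ → ℝ} {B C : ℝ} (hB : 0 ≤ B) (hBC : B * C ≤ 1 / (2 * l))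
    (hC : ∀ y, 0 ≤ y → dilationConj (fun t => ω t + D) (8 * l * y / (ω y + D)) ≤ C * (ω y + D))
    (hm : ∀ p : ℕ, ∀ v₀ : ℝ, 0 < v₀ →
      v₀ * (v₀ ^ p * Real.exp (-(B * (dilationConj (fun t => ω t + D) (2 * v₀) + 1)))) ≤ m p) :
    ∃ Q : ℝ, ∀ p : ℕ, Wseq ω l p ≤ Q * (1 / 2) ^ p * (p.factorial * m p) := by
  obtain ⟨C₁, hC₁, hC₁'⟩ := h.le_linear hcΛ (η := 1) one_pos
  have hΩ1 : 0 < ω 1 + D := h.pos 1 zero_le_one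
  have hC₁' : ∀ x, 0 ≤ x → ∀ y, 0 ≤ y → ω (x * y) + D ≤ (1 * y + C₁) * (ω x + D) := hC₁'
  set b := 4 * l / ((1 + C₁) * (ω 1 + D)) with hb
  have hb0 : 0 < b := by positivity
  refine ⟨Real.exp (B + D / l) / b, fun p => Wseq_le_of_forall hl p fun y hy => ?_⟩
  have hy0 : 0 < y := by linarith
  have hΩ : 0 < ω y + D := h.pos y hy0.le
  set X := (ω y + D) / (2 * l) with hX
  have hX0 : 0 < X := by positivity
  set v₀ := 2 * y / X with hv
  have hv0 : 0 < v₀ := by positivity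
  have hbv : b ≤ v₀ := by
    have h1 := hC₁' 1 zero_le_one y hy0.le
    simp only [one_mul] at h1
    have h2 : ω y + D ≤ (1 + C₁) * (ω 1 + D) * y := by
      have h4 : y + C₁ ≤ (1 + C₁) * y := by nlinarith
      linarith [mul_le_mul_of_nonneg_right h4 hΩ1.le]
    rw [hb, hv, hX, div_le_div_iff₀ (by positivity) (by positivity)]
    have h3 : 4 * l * ((ω y + D) / (2 * l)) = 2 * (ω y + D) := by field_simp; ring
    rw [h3]
    linarith
  have hv_two : 2 * v₀ = 8 * l * y / (ω y + D) := by rw [hv, hX]; field_simp; ring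
  have hσ := hC y hy0.le
  rw [← hv_two] at hσ
  have hexp : Real.exp (-B) * Real.exp (-X) ≤
      Real.exp (-(B * (dilationConj (fun t => ω t + D) (2 * v₀) + 1))) := by
    rw [← Real.exp_add]
    apply Real.exp_le_exp.2
    have h1 := mul_le_mul_of_nonneg_left hσ hB
    have h2 := mul_le_mul_of_nonneg_right hBC hΩ.le
    have h3 : 1 / (2 * l) * (ω y + D) = X := by rw [hX]; ring
    linarith
  have hm1 := hm p v₀ hv0
  have hfac : 0 < (p.factorial : ℝ) := by positivity
  have hXp : X ^ p ≤ p.factorial * Real.exp X := by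
    have := Real.pow_div_factorial_le_exp X hX0.le p
    rwa [div_le_iff₀ hfac, mul_comm] at this
  have hpow : 2 ^ p * y ^ p * Real.exp (-X) ≤ p.factorial * v₀ ^ p := by
    rw [hv, div_pow, mul_pow, ← mul_div_assoc, le_div_iff₀ (by positivity)]
    calc 2 ^ p * y ^ p * Real.exp (-X) * X ^ p
        ≤ 2 ^ p * y ^ p * Real.exp (-X) * (p.factorial * Real.exp X) := by gcongr
      _ = p.factorial * (2 ^ p * y ^ p) * (Real.exp (-X) * Real.exp X) := by ring
      _ = _ := by rw [← Real.exp_add, neg_add_cancel, Real.exp_zero, mul_one]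
  have hmain : b * (2 ^ p * y ^ p * Real.exp (-X)) * (Real.exp (-B) * Real.exp (-X)) ≤
      p.factorial * m p := by
    calc _ ≤ v₀ * (p.factorial * v₀ ^ p) *
          Real.exp (-(B * (dilationConj (fun t => ω t + D) (2 * v₀) + 1))) := by gcongr
      _ = p.factorial * (v₀ * (v₀ ^ p *
          Real.exp (-(B * (dilationConj (fun t => ω t + D) (2 * v₀) + 1))))) := by ring
      _ ≤ _ := by gcongr
  have hXX : Real.exp (-(ω y / l)) = Real.exp (B + D / l) * (Real.exp (-X) * Real.exp (-B) *
      Real.exp (-X)) := by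
    rw [← Real.exp_add, ← Real.exp_add, ← Real.exp_add]
    congr 1
    rw [hX]
    field_simp
    ring
  calc y ^ p * Real.exp (-(ω y / l))
      = Real.exp (B + D / l) / b * (1 / 2) ^ p *
        (b * (2 ^ p * y ^ p * Real.exp (-X)) * (Real.exp (-B) * Real.exp (-X))) := by
        rw [hXX, div_pow, one_pow]
        field_simp
    _ ≤ _ := by gcongr

lemma exists_momentKernel (hω : InW0 ω) (hD : 0 < D)
    (h : ScaleGrowth (fun t => ω t + D) Λ₀ c) {K : ℝ} (hcK : c < K) (hK : K < Λ₀) {α : ℝ}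
    (hα : 0 < α) (hα2 : α < 2) (hKα : K ^ α < Λ₀ / K) {l : ℝ} (hl : 0 < l) :
    ∃ (k : ℂ → ℂ) (E m : ℕ → ℝ) (δ P Q : ℝ), 0 < δ ∧ MomentKernel k α E ∧
      (∀ N : ℕ, N.factorial * E N = P * (Real.exp 1 ^ N * Wseq ω (1 / δ) N)) ∧
      (∀ p, 0 < m p) ∧ (∀ p, rayMoment k p (Ioi 0) 1 = m p) ∧
      ∀ p : ℕ, Wseq ω l p ≤ Q * (1 / 2) ^ p * (p.factorial * m p) := by
  have hcΛ := hcK.trans hK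
  have hc := h.one_lt
  have hK0 : 0 < K := by linarith
  set σ := dilationConj fun t => ω t + D with hσ
  have hσg : ScaleGrowth σ (Λ₀ / K) c := h.dilationConj_scaleGrowth hcK.le hK
  set μ := Λ₀ / K with hμ
  have hμ0 : 0 < μ := by linarith [hσg.one_lt_scale]
  set Λ := μ ^ (1 / α) with hΛdef
  have hΛμ : Λ ^ α = μ := by
    rw [hΛdef, ← Real.rpow_mul hμ0.le, one_div_mul_cancel hα.ne', Real.rpow_one]
  have hΛ0 : 0 < Λ := Real.rpow_pos_of_pos hμ0 _
  have hΛ : c < Λ := by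
    refine hcK.trans ?_
    rw [← Real.rpow_lt_rpow_iff hK0.le hΛ0.le hα, hΛμ]
    exact hKα
  obtain ⟨C₁, hC₁, hker⟩ := exists_expKernel_ofReal hσg hΛ hα hΛμ
  obtain ⟨C₂, hC₂, hdil⟩ := h.dilationConj_div_le hcΛ (M := 8 * l) (by positivity)
  set η := 1 / (8 * Λ ^ 2 * c) with hη
  have hη0 : 0 < η := by positivity
  set ε := min (2 / η) (1 / (2 * l * C₁ * C₂)) with hε
  have hε0 : 0 < ε := by positivity
  obtain ⟨κ, hκ⟩ := hker ε hε0.le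
  set δ := ε * η / 2 with hδ
  have hδ0 : 0 < δ := by positivity
  have hδ1 : δ ≤ 1 := by
    have h1 : ε ≤ 2 / η := min_le_left _ _
    rw [le_div_iff₀ hη0] at h1
    linarith
  have hBC : ε * C₁ * C₂ ≤ 1 / (2 * l) := by
    have h1 : ε ≤ 1 / (2 * l * C₁ * C₂) := min_le_right _ _
    calc ε * C₁ * C₂ ≤ 1 / (2 * l * C₁ * C₂) * C₁ * C₂ := by gcongr
      _ = _ := by field_simp
  set P := Real.exp (ε * η * σ 1) *
    (Wseq ω (1 / δ) 0 + Real.exp 1 ^ 2 * Wseq ω (1 / δ) 2) with hP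
  have hk : MomentKernel (expKernel σ μ Λ α ε) α
      (fun N => P * (Real.exp 1 ^ N * Wseq ω (1 / δ) N / N.factorial)) := by
    refine ⟨hα, hα2, differentiableOn_expKernel hσg hΛ hα hα2, fun w hw N => ?_⟩
    have h1 := norm_expKernel_le hσg hΛ hα hΛμ hε0.le hw
    have h2 := pow_mul_exp_dilationConj_le hω hD h hcΛ hδ0 hδ1 N (norm_nonneg w)
    rw [← hσ, show 2 * δ = ε * η by rw [hδ]; ring] at h2
    rw [hP, mul_assoc (Real.exp _)]
    calc _ ≤ Real.exp (ε * η * σ 1) * Real.exp (-(ε * η * σ ‖w‖)) *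
          (‖w‖ ^ N * (1 + ‖w‖ ^ 2)) := by gcongr
      _ ≤ _ := by rw [mul_assoc]; gcongr
  have hκ1 : ∀ v : ℝ, 0 < v → expKernel σ μ Λ α ε v = κ v := fun v hv => (hκ v hv).1
  have hκ0 : ∀ v : ℝ, 0 < v → 0 < κ v := fun v hv => (Real.exp_pos _).trans_le (hκ v hv).2
  have hmom : ∀ p : ℕ, ∀ v₀ : ℝ, 0 < v₀ →
      v₀ * (v₀ ^ p * Real.exp (-(ε * C₁ * (σ (2 * v₀) + 1)))) ≤
        ∫ x in Ioi (0 : ℝ), κ x * x ^ p := by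
    intro p v₀ hv₀
    refine hk.le_moment hκ1 hκ0 hv₀ (Real.exp_pos _).le (fun v hv => ?_) p
    have hv0 : 0 < v := hv₀.trans hv.1
    refine le_trans (Real.exp_le_exp.2 ?_) (hκ v hv0).2
    have h1 : σ v ≤ σ (2 * v₀) :=
      hσg.mono (mem_Ici.2 hv0.le) (mem_Ici.2 (by positivity)) hv.2
    rw [neg_le_neg_iff, mul_assoc]
    gcongr
  obtain ⟨Q, hQ⟩ := exists_Wseq_le_moment h hcΛ hl (by positivity) hBC hdil hmom
  refine ⟨_, _, _, δ, P, Q, hδ0, hk, fun N => ?_, fun p => ?_,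
    MomentKernel.rayMoment_Ioi_one hκ1, hQ⟩
  · field_simp
  · exact lt_of_lt_of_le (by positivity) (hmom p 1 one_pos)

end Construction

lemma exists_Pcond_of_lt {ω : ℝ → ℝ} {γ : ℝ} (hγ0 : 0 < γ)
    (hγ : ENNReal.ofReal γ < gammaIndex ω - 1) : ∃ β : ℝ, γ + 1 < β ∧ Pcond ω β := by
  have h1 : ENNReal.ofReal (γ + 1) < gammaIndex ω := by
    rw [ENNReal.ofReal_add hγ0.le zero_le_one, ENNReal.ofReal_one]
    exact lt_tsub_iff_right.1 hγ
  rw [gammaIndex] at h1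
  simp only [lt_iSup_iff] at h1
  obtain ⟨β, ⟨hβ0, hβ⟩, hlt⟩ := h1
  exact ⟨β, (ENNReal.ofReal_lt_ofReal_iff hβ0).1 hlt, hβ⟩

/-- Continuous linear right inverse of the Borel map on a single weighted space. -/
theorem exists_extension_operator {ω : ℝ → ℝ} (hω : InW0 ω) {γ : ℝ} (hγ0 : 0 < γ)
    (hγ : ENNReal.ofReal γ < min 2 (gammaIndex ω - 1)) {l : ℝ} (hl : 0 < l) :
    ∃ d'' : ℕ, 1 ≤ d'' ∧
      ∃ E : (ℕ → ℂ) →ₗ[ℂ] (ℂ → ℂ), ∃ C : ℝ, 0 ≤ C ∧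
        ∀ lam : ℕ → ℂ, ∀ A : ℝ, (∀ p : ℕ, ‖lam p‖ ≤ A * Wseq ω l p) →
          DifferentiableOn ℂ (E lam) (sector γ) ∧
          (∀ z ∈ sector γ, ∀ p : ℕ, ‖iteratedDeriv p (E lam) z‖ ≤ C * A * Wseq ω (d'' * l) p) ∧
          (∀ p : ℕ, Tendsto (iteratedDeriv p (E lam))
            (nhdsWithin 0 (sector γ)) (nhds (lam p))) := by
  have hγ2 : γ < 2 := by
    have := hγ.trans_le (min_le_left _ _)
    rwa [← ENNReal.ofReal_ofNat 2, ENNReal.ofReal_lt_ofReal_iff two_pos] at this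
  obtain ⟨β, hγβ, hβ⟩ := exists_Pcond_of_lt hγ0 (hγ.trans_le (min_le_right _ _))
  obtain ⟨K, c, D, hcK, hD, h⟩ := exists_scaleGrowth hω hβ (by linarith)
  have hK1 : 1 < K := h.one_lt.trans hcK
  have hKβ : K < K ^ β := by
    simpa using Real.rpow_lt_rpow_of_exponent_lt hK1 (show (1 : ℝ) < β by linarith)
  obtain ⟨α, hγα, hα⟩ := exists_between (lt_min hγ2 (show γ < β - 1 by linarith))
  obtain ⟨hα2, hαβ⟩ := lt_min_iff.1 hα
  have hKα : K ^ α < K ^ β / K := by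
    rw [← Real.rpow_sub_one (by positivity)]
    exact Real.rpow_lt_rpow_of_exponent_lt hK1 hαβ
  obtain ⟨k, E, m, δ, P, Q, hδ, hk, hE, hm0, hm, hW⟩ :=
    exists_momentKernel hω hD h hcK hKβ (hγ0.trans hγα) hα2 hKα hl
  obtain ⟨T, hT⟩ := hk.exists_linearMap hm0 hm (Wseq_pos ω l) hW
  obtain ⟨ρ, hρ, hball⟩ := exists_closedBall_subset_sector hγα hγ0 hα2
  have hB : 1 ≤ (1 + ρ) / ρ * Real.exp 1 := by
    have h1 : 1 ≤ (1 + ρ) / ρ := by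
      rw [one_le_div hρ]
      linarith
    exact one_le_mul_of_one_le_of_one_le h1 (Real.one_le_exp zero_le_one)
  obtain ⟨L', C, hL', hC, hBW⟩ :=
    exists_pow_mul_Wseq_le hω hD h (hcK.trans hKβ) hB (one_div_pos.2 hδ)
  obtain ⟨n, hn⟩ := exists_nat_ge (L' / l)
  have hL'n : L' ≤ ((n + 1 : ℕ) : ℝ) * l := by
    rw [div_le_iff₀ hl] at hn
    push_cast
    linarith
  refine ⟨n + 1, by omega, T, |Q * Real.pi * P| * C, by positivity, fun lam A hlam => ?_⟩
  obtain ⟨hd, has⟩ := hT lam A hlam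
  have hA : 0 ≤ A := nonneg_of_mul_nonneg_left ((norm_nonneg _).trans (hlam 0)) (Wseq_pos ω l 0)
  refine ⟨hd.mono (sector_mono hγα.le), fun z hz p => ?_, fun p => ?_⟩
  · have h1 := norm_iteratedDeriv_le (G := fun N => A * Q * Real.pi * E N) hρ hα2 hball hd has hz p
    calc ‖iteratedDeriv p (T lam) z‖
        ≤ p.factorial * (A * Q * Real.pi * E p) * ((1 + ρ) / ρ) ^ p := h1
      _ = A * (Q * Real.pi) * ((1 + ρ) / ρ) ^ p * (p.factorial * E p) := by ring
      _ = Q * Real.pi * P * (A * (((1 + ρ) / ρ * Real.exp 1) ^ p * Wseq ω (1 / δ) p)) := by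
        rw [hE, mul_pow]
        ring
      _ ≤ |Q * Real.pi * P| * (A * (C * Wseq ω ((n + 1 : ℕ) * l) p)) := by
        have hpos := Wseq_pos ω (1 / δ) p
        have h2 := Wseq_mono hω hL' hL'n p
        refine (mul_le_mul_of_nonneg_right (le_abs_self _) (by positivity)).trans ?_
        have h3 := (hBW p).trans (mul_le_mul_of_nonneg_left h2 hC.le)
        gcongr
      _ = _ := by ring
  · have h1 := tendsto_iteratedDeriv (G := fun N => A * Q * Real.pi * E N) hρ hα2 hball hd has p
    rwa [mul_div_cancel₀ _ (by exact_mod_cast p.factorial_ne_zero)] at h1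

/-- Roumieu extension theorem, weight-function case, sector in `ℂ`:
existence of a continuous linear extension operator
`E : Λ¹_{ω,l} → A_{ω,d''l}(S_γ)` right-inverting the Borel map; in particular the
Borel map on the Roumieu class is surjective. -/
theorem roumieu_extension_weight_function
    (ω : ℝ → ℝ) (hω : InW0 ω) (hγω : 1 < gammaIndex ω)
    (γ : ℝ) (hγ0 : 0 < γ)
    (hγ : ENNReal.ofReal γ < min 2 (gammaIndex ω - 1))
    (l : ℝ) (hl : 0 < l) :
    (∃ d'' : ℕ, 1 ≤ d'' ∧
      ∃ E : (ℕ → ℂ) →ₗ[ℂ] (ℂ → ℂ), ∃ C : ℝ, 0 ≤ C ∧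
        ∀ lam : ℕ → ℂ, ∀ A : ℝ,
          (∀ p : ℕ, ‖lam p‖ ≤ A * Real.exp ((1 / l) * phiStar ω (l * (p : ℝ)))) →
          DifferentiableOn ℂ (E lam) (sector γ) ∧
          (∀ z ∈ sector γ, ∀ p : ℕ,
            ‖iteratedDeriv p (E lam) z‖ ≤
              C * A * Real.exp ((1 / ((d'' : ℝ) * l)) * phiStar ω (((d'' : ℝ) * l) * (p : ℝ)))) ∧
          (∀ p : ℕ, Filter.Tendsto (iteratedDeriv p (E lam))
            (nhdsWithin 0 (sector γ)) (nhds (lam p)))) ∧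
    (∀ lam : ℕ → ℂ,
      (∃ l' : ℝ, 0 < l' ∧ ∃ A : ℝ,
        ∀ p : ℕ, ‖lam p‖ ≤ A * Real.exp ((1 / l') * phiStar ω (l' * (p : ℝ)))) →
      ∃ f : ℂ → ℂ, DifferentiableOn ℂ f (sector γ) ∧
        (∃ l'' : ℝ, 0 < l'' ∧ ∃ C : ℝ,
          ∀ z ∈ sector γ, ∀ p : ℕ,
            ‖iteratedDeriv p f z‖ ≤ C * Real.exp ((1 / l'') * phiStar ω (l'' * (p : ℝ)))) ∧
        (∀ p : ℕ, Filter.Tendsto (iteratedDeriv p f)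
          (nhdsWithin 0 (sector γ)) (nhds (lam p)))) := by
  have hext := fun l' (hl' : 0 < l') => exists_extension_operator hω hγ0 hγ hl'
  refine ⟨hext l hl, fun lam ⟨l', hl', A, hA⟩ => ?_⟩
  obtain ⟨d, hd, E, C, -, hE⟩ := hext l' hl'
  obtain ⟨h1, h2, h3⟩ := hE lam A hA
  have hd0 : (0 : ℝ) < d := by exact_mod_cast hd
  exact ⟨E lam, h1, ⟨d * l', by positivity, C * A, h2⟩, h3⟩
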